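/- arXiv:2511.03872 — 3 statements merged into one kernel-verified Lean document; each statement's English description precedes it below -/
import Mathlib

section
/- Let W ⊊ ℂ be a simply connected domain, a ∈ W, and φ_a : 𝔻 → W a Riemann map with φ_a(0) = a. Suppose the Hardy norm ‖φ_a‖_{H^p} = (sup_{r<1} (1/2π) ∫₀^{2π} |φ_a(r e^{iθ})|^p dθ)^{1/p} is finite for some p > 0. If f is analytic on W with limsup_{z → ∂W} |f(z)| ≤ K < ∞ and |f(z)| ≤ C e^{C|z|^p} on W for some C > 0, then |f(z)| ≤ K for all z ∈ W. -/
open Complex Metric Set Filter Topology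

theorem circleIntegrable_of_continuousOn_ball {E : Type*} [NormedAddCommGroup E] {u : ℂ → E}
    (hu : ContinuousOn u (ball 0 1)) {r : ℝ} (hr : r ∈ Ioo (0 : ℝ) 1) : CircleIntegrable u 0 r :=
  (hu.mono (sphere_subset_closedBall.trans (closedBall_subset_ball hr.2))).circleIntegrable hr.1.le

theorem diffContOnCl_ball_abs {u : ℂ → ℂ} (hu : DifferentiableOn ℂ u (ball 0 1)) {r : ℝ}
    (hr : r ∈ Ioo (0 : ℝ) 1) : DiffContOnCl ℂ u (ball 0 |r|) := by
  rw [abs_of_pos hr.1]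
  exact hu.diffContOnCl_ball (closedBall_subset_ball hr.2)

theorem differentiableOn_iterate_dslope {h : ℂ → ℂ} (hh : DifferentiableOn ℂ h (ball 0 1))
    (n : ℕ) : DifferentiableOn ℂ ((fun u : ℂ → ℂ ↦ dslope u 0)^[n] h) (ball 0 1) := by
  induction n with
  | zero => exact hh
  | succ n ih =>
    rw [Function.iterate_succ_apply']
    exact (differentiableOn_dslope (ball_mem_nhds 0 one_pos)).2 ih

theorem eq_add_mul_dslope_zero (u : ℂ → ℂ) (z : ℂ) : u z = u 0 + z * dslope u 0 z := by
  have := sub_smul_dslope u 0 z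
  simp only [sub_zero, smul_eq_mul] at this
  rw [this]; ring

theorem eq_sum_add_pow_mul_iterate_dslope (h : ℂ → ℂ) (N : ℕ) (z : ℂ) :
    h z = ∑ n ∈ Finset.range N, ((fun u : ℂ → ℂ ↦ dslope u 0)^[n] h) 0 * z ^ n
      + z ^ N * ((fun u : ℂ → ℂ ↦ dslope u 0)^[N] h) z := by
  induction N with
  | zero => simp
  | succ N ih =>
    rw [ih, Finset.sum_range_succ, eq_add_mul_dslope_zero ((fun u : ℂ → ℂ ↦ dslope u 0)^[N] h) z,
      Function.iterate_succ_apply']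
    ring

/-- The square mean splits off the value at the centre. -/
theorem circleAverage_norm_sq_eq_add_dslope {u : ℂ → ℂ} (hu : DifferentiableOn ℂ u (ball 0 1))
    {r : ℝ} (hr : r ∈ Ioo (0 : ℝ) 1) :
    Real.circleAverage (fun z ↦ ‖u z‖ ^ 2) 0 r
      = ‖u 0‖ ^ 2 + r ^ 2 * Real.circleAverage (fun z ↦ ‖dslope u 0 z‖ ^ 2) 0 r := by
  have hd : DifferentiableOn ℂ (dslope u 0) (ball 0 1) :=
    (differentiableOn_dslope (ball_mem_nhds 0 one_pos)).2 hu
  set v : ℂ → ℂ := fun z ↦ (starRingEnd ℂ) (u 0) * (z * dslope u 0 z) with hv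
  have hvd : DifferentiableOn ℂ v (ball 0 1) := by
    exact (differentiableOn_id.mul hd).const_mul _
  have hv0 : Real.circleAverage v 0 r = 0 := by
    rw [(diffContOnCl_ball_abs hvd hr).circleAverage]; simp [hv]
  have hre : Real.circleAverage (fun z ↦ (v z).re) 0 r = 0 := by
    have := Complex.reCLM.circleAverage_comp_comm
      (circleIntegrable_of_continuousOn_ball hvd.continuousOn hr)
    rw [hv0] at this
    simpa [Function.comp_def] using this
  have hc : Real.circleAverage (fun z ↦ ‖u z‖ ^ 2) 0 r
      = Real.circleAverage (fun z ↦ ‖u 0‖ ^ 2 + (r ^ 2 * ‖dslope u 0 z‖ ^ 2 + 2 * (v z).re)) 0 r := by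
    apply Real.circleAverage_congr_sphere
    intro z hz
    have hz' : ‖z‖ = r := by simpa [abs_of_pos hr.1] using hz
    have h1 : u z = u 0 + z * dslope u 0 z := eq_add_mul_dslope_zero u z
    have h2 : r ^ 2 * ‖dslope u 0 z‖ ^ 2 = ‖z * dslope u 0 z‖ ^ 2 := by
      rw [norm_mul, hz', mul_pow]
    simp only [h2, hv]
    rw [h1]
    generalize z * dslope u 0 z = w
    simp only [← Complex.normSq_eq_norm_sq, Complex.normSq_apply, Complex.add_re, Complex.add_im,
      Complex.mul_re, Complex.conj_re, Complex.conj_im]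
    ring
  have i1 : ContinuousOn (fun z ↦ r ^ 2 * ‖dslope u 0 z‖ ^ 2) (ball 0 1) :=
    continuousOn_const.mul (hd.continuousOn.norm.pow 2)
  have i2 : ContinuousOn (fun z ↦ 2 * (v z).re) (ball 0 1) :=
    continuousOn_const.mul (Complex.continuous_re.comp_continuousOn hvd.continuousOn)
  have i12 : ContinuousOn (fun z ↦ r ^ 2 * ‖dslope u 0 z‖ ^ 2 + 2 * (v z).re) (ball 0 1) :=
    i1.add i2
  rw [hc, Real.circleAverage_fun_add (circleIntegrable_const _ _ _)
      (circleIntegrable_of_continuousOn_ball i12 hr), Real.circleAverage_const,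
    Real.circleAverage_fun_add (circleIntegrable_of_continuousOn_ball i1 hr)
      (circleIntegrable_of_continuousOn_ball i2 hr)]
  have e1 := Real.circleAverage_fun_smul (𝕜 := ℝ) (a := r ^ 2) (f := fun z ↦ ‖dslope u 0 z‖ ^ 2)
    (c := 0) (R := r)
  have e2 := Real.circleAverage_fun_smul (𝕜 := ℝ) (a := (2 : ℝ)) (f := fun z ↦ (v z).re)
    (c := 0) (R := r)
  simp only [smul_eq_mul] at e1 e2
  rw [e1, e2, hre]
  ring

theorem circleAverage_norm_sq_eq_sum {h : ℂ → ℂ} (hh : DifferentiableOn ℂ h (ball 0 1))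
    {r : ℝ} (hr : r ∈ Ioo (0 : ℝ) 1) (N : ℕ) :
    Real.circleAverage (fun z ↦ ‖h z‖ ^ 2) 0 r
      = ∑ n ∈ Finset.range N, ‖((fun u : ℂ → ℂ ↦ dslope u 0)^[n] h) 0‖ ^ 2 * r ^ (2 * n)
        + r ^ (2 * N) * Real.circleAverage
          (fun z ↦ ‖((fun u : ℂ → ℂ ↦ dslope u 0)^[N] h) z‖ ^ 2) 0 r := by
  induction N with
  | zero => simp
  | succ N ih =>
    rw [ih, Finset.sum_range_succ,
      circleAverage_norm_sq_eq_add_dslope (differentiableOn_iterate_dslope hh N) hr,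
      Function.iterate_succ_apply']
    ring

theorem norm_sq_le_circleAverage {u : ℂ → ℂ} (hu : DifferentiableOn ℂ u (ball 0 1))
    {r : ℝ} (hr : r ∈ Ioo (0 : ℝ) 1) {z : ℂ} (hz : ‖z‖ < r) :
    ‖u z‖ ^ 2 ≤ r / (r - ‖z‖) * Real.circleAverage (fun w ↦ ‖u w‖ ^ 2) 0 r := by
  have h1 := (diffContOnCl_ball_abs (hu.pow 2) hr).circleAverage_smul_div (w := z)
    (by simpa [abs_of_pos hr.1] using hz)
  have hc : ContinuousOn (fun w ↦ (r / (r - ‖z‖)) • ‖u w‖ ^ 2) (ball 0 1) :=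
    (hu.continuousOn.norm.pow 2).const_smul (r / (r - ‖z‖))
  rw [← smul_eq_mul, ← Real.circleAverage_fun_smul, ← norm_pow]
  change ‖(u ^ 2) z‖ ≤ _
  rw [← h1, Real.circleAverage, Real.circleAverage, norm_smul, smul_eq_mul, Real.norm_of_nonneg
    (by positivity)]
  gcongr
  apply intervalIntegral.norm_integral_le_of_norm_le (by positivity) _
    (circleIntegrable_of_continuousOn_ball hc hr)
  refine Filter.Eventually.of_forall fun t _ ↦ ?_
  have ht : ‖circleMap 0 r t‖ = r := by simp [abs_of_pos hr.1]
  have h2 : r - ‖z‖ ≤ ‖circleMap 0 r t - z‖ := by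
    simpa [ht] using norm_sub_norm_le (circleMap 0 r t) z
  simp only [sub_zero, smul_eq_mul, norm_mul, norm_div, ht, Pi.pow_apply, norm_pow]
  have : 0 < r - ‖z‖ := by linarith
  have := hr.1.le
  gcongr

theorem exists_norm_sub_circleAverage_le {h : ℂ → ℂ} (hh : DifferentiableOn ℂ h (ball 0 1))
    {M : ℝ} (hM : ∀ r ∈ Ioo (0 : ℝ) 1, Real.circleAverage (fun z ↦ ‖h z‖ ^ 2) 0 r ≤ M)
    {η : ℝ} (hη : 0 < η) :
    ∃ B : ℝ, ∃ q : ℂ → ℂ, ∃ r₀ ∈ Ioo (0 : ℝ) 1, ContinuousOn q (ball 0 1) ∧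
      (∀ z ∈ ball (0 : ℂ) 1, ‖h z - q z‖ ≤ B) ∧
      ∀ r ∈ Ioo r₀ 1, Real.circleAverage (fun z ↦ ‖q z‖ ^ 2) 0 r ≤ η := by
  set k : ℕ → ℂ → ℂ := fun n ↦ (fun u : ℂ → ℂ ↦ dslope u 0)^[n] h
  have hkd (n) : DifferentiableOn ℂ (k n) (ball 0 1) := differentiableOn_iterate_dslope hh n
  set A : (ℂ → ℂ) → ℝ → ℝ := fun u r ↦ Real.circleAverage (fun z ↦ ‖u z‖ ^ 2) 0 r with hA
  have hsum {r : ℝ} (hr : r ∈ Ioo (0 : ℝ) 1) (N : ℕ) : A h r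
      = ∑ n ∈ Finset.range N, ‖k n 0‖ ^ 2 * r ^ (2 * n) + r ^ (2 * N) * A (k N) r :=
    circleAverage_norm_sq_eq_sum hh hr N
  set S := A h '' Ioo 0 1
  have hSne : S.Nonempty := ⟨_, mem_image_of_mem _ (by norm_num : (1 / 2 : ℝ) ∈ Ioo (0 : ℝ) 1)⟩
  have hSb : BddAbove S := ⟨M, by rintro _ ⟨r, hr, rfl⟩; exact hM r hr⟩
  obtain ⟨_, ⟨r₀, hr₀, rfl⟩, hlt⟩ :=
    exists_lt_of_lt_csSup hSne (by linarith : sSup S - η / 2 < sSup S)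
  obtain ⟨r₁, hr₀₁, hr₁'⟩ := exists_between hr₀.2
  have hr₁ : r₁ ∈ Ioo (0 : ℝ) 1 := ⟨hr₀.1.trans hr₀₁, hr₁'⟩
  have hbound (N : ℕ) : r₀ ^ (2 * N) * A (k N) r₀
      ≤ (r₁ / (r₁ - r₀) * M) * ((r₀ / r₁) ^ 2) ^ N := by
    have h1 : A (k N) r₀ ≤ r₁ / (r₁ - r₀) * A (k N) r₁ := by
      apply Real.circleAverage_mono_on_of_le_circle
      · exact circleIntegrable_of_continuousOn_ball ((hkd N).continuousOn.norm.pow 2) hr₀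
      · intro z hz
        have hz' : ‖z‖ = r₀ := by simpa [abs_of_pos hr₀.1] using hz
        have := norm_sq_le_circleAverage (hkd N) hr₁ (z := z) (by rw [hz']; exact hr₀₁)
        rwa [hz'] at this
    have h2 : r₁ ^ (2 * N) * A (k N) r₁ ≤ M := by
      have h3 := hsum hr₁ N
      have h4 : 0 ≤ ∑ n ∈ Finset.range N, ‖k n 0‖ ^ 2 * r₁ ^ (2 * n) :=
        Finset.sum_nonneg fun n _ ↦ mul_nonneg (by positivity) (pow_nonneg hr₁.1.le _)
      linarith [hM r₁ hr₁]
    have hp₁ := hr₁.1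
    have hp₀ := hr₀.1
    have h5 : 0 < r₁ - r₀ := by linarith
    calc r₀ ^ (2 * N) * A (k N) r₀ ≤ r₀ ^ (2 * N) * (r₁ / (r₁ - r₀) * A (k N) r₁) := by gcongr
      _ = r₁ / (r₁ - r₀) * (r₁ ^ (2 * N) * A (k N) r₁) * ((r₀ / r₁) ^ 2) ^ N := by
        rw [← pow_mul, div_pow]; field_simp
      _ ≤ _ := by gcongr
  have hq : (r₀ / r₁) ^ 2 < 1 := by
    rw [sq_lt_one_iff₀ (div_nonneg hr₀.1.le hr₁.1.le), div_lt_one hr₁.1]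
    exact hr₀₁
  have hlim : Tendsto (fun N : ℕ ↦ (r₁ / (r₁ - r₀) * M) * ((r₀ / r₁) ^ 2) ^ N) atTop (𝓝 0) := by
    simpa using (tendsto_pow_atTop_nhds_zero_of_lt_one (by positivity) hq).const_mul
      (r₁ / (r₁ - r₀) * M)
  obtain ⟨N, hN⟩ := (hlim.eventually (gt_mem_nhds (by linarith : (0 : ℝ) < η / 2))).exists
  refine ⟨∑ n ∈ Finset.range N, ‖k n 0‖, fun z ↦ z ^ N * k N z, r₀, hr₀,
    (continuousOn_id.pow N).mul (hkd N).continuousOn, fun z hz ↦ ?_, fun r hr ↦ ?_⟩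
  · rw [eq_sum_add_pow_mul_iterate_dslope h N z, add_sub_cancel_right]
    refine norm_sum_le_of_le _ fun n _ ↦ ?_
    rw [norm_mul, norm_pow]
    exact mul_le_of_le_one_right (norm_nonneg _)
      (pow_le_one₀ (norm_nonneg _) (mem_ball_zero_iff.1 hz).le)
  · have hr' : r ∈ Ioo (0 : ℝ) 1 := ⟨hr₀.1.trans hr.1, hr.2⟩
    have e : Real.circleAverage (fun z ↦ ‖z ^ N * k N z‖ ^ 2) 0 r = r ^ (2 * N) * A (k N) r := by
      rw [hA, ← smul_eq_mul, ← Real.circleAverage_fun_smul]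
      apply Real.circleAverage_congr_sphere
      intro z hz
      have hz' : ‖z‖ = r := by simpa [abs_of_pos hr'.1] using hz
      simp only [norm_mul, norm_pow, hz', smul_eq_mul]
      ring
    rw [e]
    have h1 : A h r ≤ sSup S := le_csSup hSb (mem_image_of_mem _ hr')
    have h2 : ∑ n ∈ Finset.range N, ‖k n 0‖ ^ 2 * r₀ ^ (2 * n)
        ≤ ∑ n ∈ Finset.range N, ‖k n 0‖ ^ 2 * r ^ (2 * n) := by
      refine Finset.sum_le_sum fun n _ ↦ ?_
      have := hr₀.1.le
      have := hr.1.le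
      gcongr
    linarith [hsum hr' N, hsum hr₀ N, hbound N]

theorem log_norm_add_divisor_mul_log_le {G : ℂ → ℂ} {r : ℝ} (hr : 0 < r)
    (hG : AnalyticOnNhd ℂ G (closedBall 0 |r|)) (h0 : G 0 ≠ 0) (u : ℂ) :
    Real.log ‖G 0‖ + MeromorphicOn.divisor G (closedBall 0 |r|) u * Real.log (r * ‖0 - u‖⁻¹)
      ≤ Real.circleAverage (fun z ↦ Real.log ‖G z‖) 0 r := by
  rw [AnalyticOnNhd.circleAverage_log_norm hr.ne' hG h0, add_comm]
  gcongr
  apply single_le_finsum u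
    (f := fun u ↦ (MeromorphicOn.divisor G (closedBall 0 |r|) u : ℝ) * Real.log (r * ‖0 - u‖⁻¹))
  · refine ((MeromorphicOn.divisor G _).finiteSupport (isCompact_closedBall 0 |r|)).subset ?_
    intro v hv
    simp only [Function.mem_support] at hv ⊢
    contrapose! hv
    simp [hv]
  · intro v
    by_cases hv : v ∈ closedBall (0 : ℂ) |r|
    · refine mul_nonneg (by exact_mod_cast MeromorphicOn.AnalyticOnNhd.divisor_nonneg hG v) ?_
      rcases eq_or_ne v 0 with rfl | hv0
      · simp
      · apply Real.log_nonneg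
        rw [mem_closedBall_zero_iff, abs_of_pos hr] at hv
        rw [zero_sub, norm_neg, ← div_eq_mul_inv, one_le_div (norm_pos_iff.2 hv0)]
        exact hv
    · simp [Function.locallyFinsuppWithin.apply_eq_zero_of_notMem _ hv]

theorem log_norm_le_circleAverage {G : ℂ → ℂ} {r : ℝ} (hr : 0 < r)
    (hG : AnalyticOnNhd ℂ G (closedBall 0 |r|)) (h0 : G 0 ≠ 0) :
    Real.log ‖G 0‖ ≤ Real.circleAverage (fun z ↦ Real.log ‖G z‖) 0 r := by
  simpa using log_norm_add_divisor_mul_log_le hr hG h0 0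

theorem log_norm_add_log_div_le_circleAverage {G : ℂ → ℂ} {r : ℝ} (hr : 0 < r)
    (hG : AnalyticOnNhd ℂ G (closedBall 0 |r|)) (h0 : G 0 ≠ 0) {z₀ : ℂ} (hz₀ : ‖z₀‖ ≤ r)
    (hGz : G z₀ = 0) :
    Real.log ‖G 0‖ + Real.log (r / ‖z₀‖) ≤ Real.circleAverage (fun z ↦ Real.log ‖G z‖) 0 r := by
  have hmem : z₀ ∈ closedBall (0 : ℂ) |r| := by simpa [abs_of_pos hr] using hz₀
  have hne : z₀ ≠ 0 := by rintro rfl; exact h0 hGz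
  have htop : analyticOrderAt G z₀ ≠ ⊤ := by
    intro h
    rw [analyticOrderAt_eq_top] at h
    exact h0 (hG.eqOn_zero_of_preconnected_of_eventuallyEq_zero
      (convex_closedBall _ _).isPreconnected hmem h (mem_closedBall_self (abs_nonneg r)))
  have hzero : analyticOrderAt G z₀ ≠ 0 := by
    rw [Ne, (hG z₀ hmem).analyticOrderAt_eq_zero]
    simpa using hGz
  have hdiv : (1 : ℝ) ≤ MeromorphicOn.divisor G (closedBall 0 |r|) z₀ := by
    rw [MeromorphicOn.AnalyticOnNhd.divisor_apply hG hmem]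
    lift analyticOrderAt G z₀ to ℕ using htop with m
    have hm : m ≠ 0 := by exact_mod_cast hzero
    have : (1 : ℤ) ≤ m := by omega
    simpa using this
  refine le_trans ?_ (log_norm_add_divisor_mul_log_le hr hG h0 z₀)
  rw [zero_sub, norm_neg, ← div_eq_mul_inv]
  gcongr
  exact le_mul_of_one_le_left
    (Real.log_nonneg ((one_le_div (norm_pos_iff.2 hne)).2 hz₀)) hdiv

theorem norm_le_one_of_circleAverage_posLog_le {g : ℂ → ℂ}
    (hg : DifferentiableOn ℂ g (ball 0 1))
    (hV : ∀ η > 0, ∃ r₀ < (1 : ℝ), ∀ r ∈ Ioo (0 : ℝ) 1, r₀ < r →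
      Real.circleAverage (fun z ↦ Real.posLog ‖g z‖) 0 r ≤ η) :
    ∀ z ∈ ball (0 : ℂ) 1, ‖g z‖ ≤ 1 := by
  have han {G : ℂ → ℂ} (hG : DifferentiableOn ℂ G (ball 0 1)) {r : ℝ} (hr : r ∈ Ioo (0 : ℝ) 1) :
      AnalyticOnNhd ℂ G (closedBall 0 |r|) :=
    (hG.analyticOnNhd isOpen_ball).mono
      (by rw [abs_of_pos hr.1]; exact closedBall_subset_ball hr.2)
  have hint {G : ℂ → ℂ} (hG : DifferentiableOn ℂ G (ball 0 1)) {r : ℝ} (hr : r ∈ Ioo (0 : ℝ) 1) :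
      CircleIntegrable (fun z ↦ Real.log ‖G z‖) 0 r :=
    ((han hG hr).mono sphere_subset_closedBall).meromorphicOn.circleIntegrable_log_norm
  have hposc : ContinuousOn (fun z ↦ Real.posLog ‖g z‖) (ball 0 1) :=
    Real.continuous_posLog.comp_continuousOn hg.continuousOn.norm
  have hg0 : ‖g 0‖ ≤ 1 := by
    rcases eq_or_ne (g 0) 0 with h0 | h0
    · simp [h0]
    rw [← Real.log_nonpos_iff (norm_nonneg _)]
    refine le_of_forall_pos_le_add fun η hη ↦ ?_
    obtain ⟨r₀, hr₀, hr₀'⟩ := hV η hη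
    obtain ⟨r, hr1, hr2⟩ := exists_between (max_lt hr₀ one_pos)
    have hr : r ∈ Ioo (0 : ℝ) 1 := ⟨(le_max_right _ _).trans_lt hr1, hr2⟩
    have h1 := log_norm_le_circleAverage hr.1 (han hg hr) h0
    have h2 : Real.circleAverage (fun z ↦ Real.log ‖g z‖) 0 r
        ≤ Real.circleAverage (fun z ↦ Real.posLog ‖g z‖) 0 r :=
      Real.circleAverage_mono (hint hg hr) (circleIntegrable_of_continuousOn_ball hposc hr)
        fun z _ ↦ le_max_right _ _
    linarith [hr₀' r hr ((le_max_left _ _).trans_lt hr1)]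
  intro z₀ hz₀
  rw [mem_ball_zero_iff] at hz₀
  rcases eq_or_ne z₀ 0 with rfl | hne
  · exact hg0
  have hz₀pos : 0 < ‖z₀‖ := norm_pos_iff.2 hne
  set w := g z₀
  have hpow (n : ℕ) : ‖g 0 ^ n - w ^ n‖ ≤ ‖z₀‖ * (1 + ‖w‖ ^ n) := by
    set G : ℂ → ℂ := fun z ↦ g z ^ n - w ^ n with hGdef
    have hG : DifferentiableOn ℂ G (ball 0 1) := (hg.pow n).sub_const _
    rcases eq_or_ne (G 0) 0 with h0 | h0
    · have : ‖g 0 ^ n - w ^ n‖ = 0 := by rw [norm_eq_zero]; exact h0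
      rw [this]; positivity
    have hpt (z : ℂ) : Real.log ‖G z‖ ≤ Real.log (1 + ‖w‖ ^ n) + n * Real.posLog ‖g z‖ := by
      have hpl : 0 ≤ Real.posLog ‖g z‖ := Real.posLog_nonneg
      have hL : 0 ≤ Real.log (1 + ‖w‖ ^ n) := Real.log_nonneg (by simp)
      rcases eq_or_ne (G z) 0 with hz | hz
      · rw [hz]; simp only [norm_zero, Real.log_zero]; positivity
      · rw [Real.posLog_eq_log_max_one (norm_nonneg _), ← Real.log_pow,
          ← Real.log_mul (by positivity) (by positivity)]
        apply Real.log_le_log (norm_pos_iff.2 hz)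
        have h1 : (1 : ℝ) ≤ max 1 ‖g z‖ ^ n := one_le_pow₀ (le_max_left _ _)
        have h2 : ‖g z‖ ^ n ≤ max 1 ‖g z‖ ^ n := by gcongr; exact le_max_right _ _
        have h3 : 0 ≤ ‖w‖ ^ n := by positivity
        calc ‖G z‖ ≤ ‖g z‖ ^ n + ‖w‖ ^ n := by
              simpa only [norm_pow] using norm_sub_le (g z ^ n) (w ^ n)
          _ ≤ (1 + ‖w‖ ^ n) * max 1 ‖g z‖ ^ n := by nlinarith
    have hlog : Real.log ‖G 0‖ ≤ Real.log ‖z₀‖ + Real.log (1 + ‖w‖ ^ n) := by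
      refine le_of_forall_pos_le_add fun ε hε ↦ ?_
      obtain ⟨r₀, hr₀, hr₀'⟩ := hV (ε / (2 * (n + 1))) (by positivity)
      have hlt : max (max r₀ ‖z₀‖) (Real.exp (-(ε / 2))) < 1 :=
        max_lt (max_lt hr₀ hz₀) (by rw [Real.exp_lt_one_iff]; linarith)
      obtain ⟨r, hr1, hr2⟩ := exists_between hlt
      simp only [max_lt_iff] at hr1
      have hr : r ∈ Ioo (0 : ℝ) 1 := ⟨hz₀pos.trans hr1.1.2, hr2⟩
      have hlr : -(ε / 2) < Real.log r := by
        rw [Real.lt_log_iff_exp_lt hr.1]; exact hr1.2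
      have h1 := log_norm_add_log_div_le_circleAverage hr.1 (han hG hr) h0 hr1.1.2.le
        (sub_self (w ^ n))
      rw [Real.log_div hr.1.ne' hz₀pos.ne'] at h1
      have hc : ContinuousOn (fun z ↦ (n : ℝ) • Real.posLog ‖g z‖) (ball 0 1) :=
        hposc.const_smul (n : ℝ)
      have h2 : Real.circleAverage (fun z ↦ Real.log ‖G z‖) 0 r
          ≤ Real.circleAverage (fun z ↦ Real.log (1 + ‖w‖ ^ n) + (n : ℝ) • Real.posLog ‖g z‖) 0 r :=
        Real.circleAverage_mono (hint hG hr)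
          (circleIntegrable_of_continuousOn_ball (continuousOn_const.add hc) hr) fun z _ ↦ hpt z
      rw [Real.circleAverage_fun_add (circleIntegrable_const _ _ _)
        (circleIntegrable_of_continuousOn_ball hc hr), Real.circleAverage_const,
        Real.circleAverage_fun_smul, smul_eq_mul] at h2
      have h3 : n * Real.circleAverage (fun z ↦ Real.posLog ‖g z‖) 0 r ≤ ε / 2 := by
        calc _ ≤ n * (ε / (2 * (n + 1))) := by gcongr; exact hr₀' r hr hr1.1.1
          _ ≤ (n + 1) * (ε / (2 * (n + 1))) := by gcongr; linarith
          _ = ε / 2 := by field_simp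
      linarith
    rw [← Real.log_mul hz₀pos.ne' (by positivity)] at hlog
    exact (Real.log_le_log_iff (norm_pos_iff.2 h0) (by positivity)).1 hlog
  by_contra! hlt
  obtain ⟨n, hn⟩ := pow_unbounded_of_one_lt (2 / (1 - ‖z₀‖)) hlt
  rw [div_lt_iff₀ (by linarith)] at hn
  have h1 := hpow n
  have h2 : ‖w‖ ^ n - ‖g 0‖ ^ n ≤ ‖g 0 ^ n - w ^ n‖ := by
    rw [norm_sub_rev]; simpa only [norm_pow] using norm_sub_norm_le (w ^ n) (g 0 ^ n)
  have h3 : ‖g 0‖ ^ n ≤ 1 := pow_le_one₀ (norm_nonneg _) hg0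
  nlinarith

theorem exists_circleAverage_posLog_le {g h : ℂ → ℂ} (hg : ContinuousOn g (ball 0 1))
    (hh : DifferentiableOn ℂ h (ball 0 1)) {M : ℝ}
    (hM : ∀ r ∈ Ioo (0 : ℝ) 1, Real.circleAverage (fun z ↦ ‖h z‖ ^ 2) 0 r ≤ M)
    {A : ℝ} (hA : 0 ≤ A) (hgh : ∀ z ∈ ball (0 : ℂ) 1, Real.posLog ‖g z‖ ≤ A * (1 + ‖h z‖ ^ 2))
    (hR : ∀ R : ℝ, ∃ r₁ < (1 : ℝ), ∀ z ∈ ball (0 : ℂ) 1, r₁ < ‖z‖ → ‖h z‖ ≤ R → ‖g z‖ ≤ 1)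
    {η : ℝ} (hη : 0 < η) :
    ∃ r₀ < (1 : ℝ), ∀ r ∈ Ioo (0 : ℝ) 1, r₀ < r →
      Real.circleAverage (fun z ↦ Real.posLog ‖g z‖) 0 r ≤ η := by
  obtain ⟨B, q, r₀, hr₀, hqc, hqB, hq⟩ :=
    exists_norm_sub_circleAverage_le hh hM (η := η / (8 * A + 1)) (by positivity)
  obtain ⟨r₁, hr₁, hr₁'⟩ := hR (max (2 * B) 1)
  refine ⟨max r₀ r₁, max_lt hr₀.2 hr₁, fun r hr hlt ↦ ?_⟩
  rw [max_lt_iff] at hlt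
  have hc : ContinuousOn (fun z ↦ (8 * A) • ‖q z‖ ^ 2) (ball 0 1) :=
    (hqc.norm.pow 2).const_smul (8 * A)
  calc Real.circleAverage (fun z ↦ Real.posLog ‖g z‖) 0 r
      ≤ Real.circleAverage (fun z ↦ (8 * A) • ‖q z‖ ^ 2) 0 r := by
        refine Real.circleAverage_mono (circleIntegrable_of_continuousOn_ball
          (Real.continuous_posLog.comp_continuousOn hg.norm) hr)
          (circleIntegrable_of_continuousOn_ball hc hr) fun z hz ↦ ?_
        have hz' : ‖z‖ = r := by simpa [abs_of_pos hr.1] using hz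
        have hzb : z ∈ ball (0 : ℂ) 1 := by rw [mem_ball_zero_iff, hz']; exact hr.2
        rw [smul_eq_mul]
        rcases le_or_gt ‖h z‖ (max (2 * B) 1) with hle | hgt
        · rw [(Real.posLog_eq_zero_iff _).2
            (by rw [abs_norm]; exact hr₁' z hzb (hz' ▸ hlt.2) hle)]
          positivity
        · rw [max_lt_iff] at hgt
          have h1 : ‖h z‖ ≤ 2 * ‖q z‖ := by
            have := norm_sub_norm_le (h z) (q z)
            linarith [hqB z hzb]
          calc Real.posLog ‖g z‖ ≤ A * (1 + ‖h z‖ ^ 2) := hgh z hzb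
            _ ≤ A * (8 * ‖q z‖ ^ 2) := by gcongr; nlinarith
            _ = _ := by ring
    _ = 8 * A * Real.circleAverage (fun z ↦ ‖q z‖ ^ 2) 0 r := by
        rw [Real.circleAverage_fun_smul, smul_eq_mul]
    _ ≤ 8 * A * (η / (8 * A + 1)) := by gcongr; exact hq r ⟨hlt.1, hr.2⟩
    _ ≤ (8 * A + 1) * (η / (8 * A + 1)) := by gcongr; linarith
    _ = η := by field_simp

/-- A zero-free holomorphic function on the disc has a holomorphic power whose squared modulus is
`‖u‖ ^ p`. -/
theorem exists_differentiableOn_norm_sq_eq_rpow {u : ℂ → ℂ} (hu : DifferentiableOn ℂ u (ball 0 1))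
    (h0 : ∀ z ∈ ball (0 : ℂ) 1, u z ≠ 0) (p : ℝ) :
    ∃ h : ℂ → ℂ, DifferentiableOn ℂ h (ball 0 1) ∧
      ∀ z ∈ ball (0 : ℂ) 1, ‖h z‖ ^ 2 = ‖u z‖ ^ p := by
  have hmem : (0 : ℂ) ∈ ball (0 : ℂ) 1 := mem_ball_self one_pos
  have hd : DifferentiableOn ℂ (fun z ↦ deriv u z / u z) (ball 0 1) :=
    (hu.deriv isOpen_ball).fun_div hu h0
  obtain ⟨L, hL0, hL⟩ := hd.isExactOn_ball.with_val_at 0 (Complex.log (u 0))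
  have hder (z : ℂ) (hz : z ∈ ball (0 : ℂ) 1) :
      HasDerivAt (fun z ↦ u z * Complex.exp (-L z)) 0 z := by
    have h1 := (hu.differentiableAt (isOpen_ball.mem_nhds hz)).hasDerivAt
    have h2 : deriv u z * Complex.exp (-L z)
        + u z * (Complex.exp (-L z) * -(deriv u z / u z)) = 0 := by
      rw [mul_left_comm, mul_neg, mul_div_cancel₀ _ (h0 z hz)]
      ring
    exact h2 ▸ h1.mul (hL z hz).neg.cexp
  have hconst (z : ℂ) (hz : z ∈ ball (0 : ℂ) 1) : u z = Complex.exp (L z) := by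
    have h1 : u z * Complex.exp (-L z) = u 0 * Complex.exp (-L 0) :=
      isOpen_ball.is_const_of_deriv_eq_zero (convex_ball _ _).isPreconnected
        (fun z hz ↦ (hder z hz).differentiableAt.differentiableWithinAt)
        (fun z hz ↦ (hder z hz).deriv) hz hmem
    rw [hL0, Complex.exp_neg (Complex.log _), Complex.exp_log (h0 0 hmem),
      mul_inv_cancel₀ (h0 0 hmem), Complex.exp_neg, ← div_eq_mul_inv,
      div_eq_one_iff_eq (Complex.exp_ne_zero _)] at h1
    exact h1
  refine ⟨fun z ↦ Complex.exp ((p / 2 : ℝ) * L z), fun z hz ↦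
    ((hL z hz).differentiableAt.const_mul _).cexp.differentiableWithinAt, fun z hz ↦ ?_⟩
  rw [hconst z hz, Complex.norm_exp, Complex.norm_exp, ← Real.exp_mul, ← Real.exp_nat_mul,
    Complex.re_ofReal_mul]
  congr 1
  push_cast
  ring

/-- A univalent map of the disc is proper onto its image. -/
theorem exists_forall_lt_norm_notMem {φ : ℂ → ℂ} (hφ : DifferentiableOn ℂ φ (ball 0 1))
    (hinj : InjOn φ (ball 0 1)) {T : Set ℂ} (hT : IsCompact T) (hTφ : T ⊆ φ '' ball 0 1) :
    ∃ r₁ < (1 : ℝ), ∀ z ∈ ball (0 : ℂ) 1, r₁ < ‖z‖ → φ z ∉ T := by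
  have hopen : ∀ s ⊆ ball (0 : ℂ) 1, IsOpen s → IsOpen (φ '' s) := by
    refine ((hφ.analyticOnNhd isOpen_ball).is_constant_or_isOpen
      (convex_ball _ _).isPreconnected).resolve_left ?_
    rintro ⟨w, hw⟩
    have h1 : (0 : ℂ) ∈ ball (0 : ℂ) 1 := mem_ball_self one_pos
    have h2 : (1 / 2 : ℂ) ∈ ball (0 : ℂ) 1 := by norm_num
    have := hinj h1 h2 ((hw _ h1).trans (hw _ h2).symm)
    norm_num at this
  obtain ⟨⟨r, hr⟩, hrT⟩ := hT.elim_directed_cover (fun r : Iio (1 : ℝ) ↦ φ '' ball 0 r)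
    (fun r ↦ hopen _ (ball_subset_ball r.2.le) isOpen_ball)
    (fun w hw ↦ by
      obtain ⟨z, hz, rfl⟩ := hTφ hw
      obtain ⟨s, hs, hs1⟩ := exists_between (mem_ball_zero_iff.1 hz)
      exact mem_iUnion.2 ⟨⟨s, hs1⟩, mem_image_of_mem _ (mem_ball_zero_iff.2 hs)⟩)
    (Monotone.directed_le fun r s hrs ↦ image_mono (ball_subset_ball hrs))
  refine ⟨r, hr, fun z hz hrz hzT ↦ ?_⟩
  obtain ⟨y, hy, hyz⟩ := hrT hzT
  rw [hinj (ball_subset_ball (le_of_lt hr) hy) hz hyz, mem_ball_zero_iff] at hy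
  exact lt_asymm hy hrz

theorem isCompact_setOf_norm_sub_le_of_le_norm {W : Set ℂ} (hW : IsOpen W) {f : ℂ → ℂ}
    (hf : ContinuousOn f W) {K K' : ℝ} (hK : K < K')
    (hbd : ∀ ζ ∈ frontier W, ∀ ε > (0 : ℝ), ∀ᶠ z in 𝓝[W] ζ, ‖f z‖ ≤ K + ε) (b : ℂ) (ρ : ℝ) :
    IsCompact {w | w ∈ W ∧ ‖w - b‖ ≤ ρ ∧ K' ≤ ‖f w‖} := by
  have hsub : {w | w ∈ W ∧ ‖w - b‖ ≤ ρ ∧ K' ≤ ‖f w‖} ⊆ closedBall b ρ := fun w hw ↦ by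
    rw [mem_closedBall_iff_norm]; exact hw.2.1
  refine isCompact_of_isClosed_isBounded (isClosed_of_closure_subset fun ζ hζ ↦ ?_)
    (isBounded_closedBall.subset hsub)
  have hfreq := mem_closure_iff_frequently.1 hζ
  have hζW : ζ ∈ W := by
    by_contra hn
    have hfr : ζ ∈ frontier W := by
      rw [hW.frontier_eq]
      exact ⟨closure_mono (fun w hw ↦ hw.1) hζ, hn⟩
    have h1 := hbd ζ hfr ((K' - K) / 2) (by linarith)
    rw [eventually_nhdsWithin_iff] at h1
    obtain ⟨w, hw, hw'⟩ := (hfreq.and_eventually h1).exists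
    linarith [hw' hw.1, hw.2.2]
  refine ⟨hζW, ?_, ?_⟩
  · rw [← mem_closedBall_iff_norm]
    exact closure_minimal hsub isClosed_closedBall hζ
  · by_contra! hlt
    obtain ⟨w, hw, hw'⟩ := (hfreq.and_eventually
      ((hf.continuousAt (hW.mem_nhds hζW)).norm.eventually_lt_const hlt)).exists
    exact hw'.not_ge hw.2.2

theorem norm_add_rpow_le {E : Type*} [SeminormedAddCommGroup E] {p : ℝ} (hp : 0 ≤ p) (x y : E) :
    ‖x + y‖ ^ p ≤ 2 ^ p * (‖x‖ ^ p + ‖y‖ ^ p) := by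
  have h1 : ‖x + y‖ ≤ 2 * max ‖x‖ ‖y‖ := by
    linarith [norm_add_le x y, le_max_left ‖x‖ ‖y‖, le_max_right ‖x‖ ‖y‖]
  calc ‖x + y‖ ^ p ≤ (2 * max ‖x‖ ‖y‖) ^ p := by gcongr
    _ = 2 ^ p * max ‖x‖ ‖y‖ ^ p := Real.mul_rpow two_pos.le (by positivity)
    _ ≤ _ := by
      gcongr
      rcases max_cases ‖x‖ ‖y‖ with ⟨h, _⟩ | ⟨h, _⟩ <;> rw [h]
      · exact le_add_of_nonneg_right (by positivity)
      · exact le_add_of_nonneg_left (by positivity)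

/-- General Phragmén–Lindelöf principle for a simply connected
domain whose Riemann map has finite `H^p` Hardy norm. -/
theorem phragmen_lindelof_hardy
    (W : Set ℂ) (hWopen : IsOpen W) (hWconn : IsConnected W)
    (hWsc : SimplyConnectedSpace W) (hWne : W ≠ Set.univ)
    (a : ℂ) (ha : a ∈ W)
    (φ : ℂ → ℂ) (hφdiff : DifferentiableOn ℂ φ (ball (0:ℂ) 1))
    (hφbij : Set.BijOn φ (ball (0:ℂ) 1) W) (hφ0 : φ 0 = a)
    (p : ℝ) (hp : 0 < p)
    (hHardy : ∃ M : ℝ, ∀ r ∈ Ioo (0:ℝ) 1,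
      (1/(2*Real.pi)) * ∫ θ in (0:ℝ)..(2*Real.pi),
        ‖φ ((r:ℂ) * Complex.exp (θ * Complex.I))‖ ^ p ≤ M)
    (f : ℂ → ℂ) (hf : DifferentiableOn ℂ f W)
    (K : ℝ)
    (hbd : ∀ ζ ∈ frontier W, ∀ ε > (0:ℝ), ∀ᶠ z in 𝓝[W] ζ, ‖f z‖ ≤ K + ε)
    (C : ℝ) (hC : 0 < C)
    (hgrow : ∀ z ∈ W, ‖f z‖ ≤ C * Real.exp (C * ‖z‖ ^ p)) :
    ∀ z ∈ W, ‖f z‖ ≤ K := by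
  obtain ⟨b, hb⟩ := (ne_univ_iff_exists_notMem W).1 hWne
  have hK : 0 ≤ K := by
    obtain ⟨ζ, hζ⟩ := nonempty_frontier_iff.2 ⟨⟨a, ha⟩, hWne⟩
    have : (𝓝[W] ζ).NeBot := mem_closure_iff_nhdsWithin_neBot.1 (frontier_subset_closure hζ)
    refine le_of_forall_pos_le_add fun ε hε ↦ ?_
    obtain ⟨z, hz⟩ := (hbd ζ hζ ε hε).exists
    exact (norm_nonneg _).trans hz
  obtain ⟨h, hhd, hhp⟩ := exists_differentiableOn_norm_sq_eq_rpow (hφdiff.sub_const b)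
    (fun z hz h0 ↦ hb (sub_eq_zero.1 h0 ▸ hφbij.mapsTo hz)) p
  obtain ⟨M, hM⟩ := hHardy
  have hφp : ContinuousOn (fun z ↦ ‖φ z‖ ^ p) (ball 0 1) :=
    hφdiff.continuousOn.norm.rpow_const fun _ _ ↦ Or.inr hp.le
  have hhM (r : ℝ) (hr : r ∈ Ioo (0 : ℝ) 1) :
      Real.circleAverage (fun z ↦ ‖h z‖ ^ 2) 0 r ≤ 2 ^ p * (M + ‖b‖ ^ p) := by
    have hc : ContinuousOn (fun z ↦ (2 : ℝ) ^ p • (‖φ z‖ ^ p + ‖b‖ ^ p)) (ball 0 1) :=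
      (hφp.add continuousOn_const).const_smul ((2 : ℝ) ^ p)
    calc Real.circleAverage (fun z ↦ ‖h z‖ ^ 2) 0 r
        ≤ Real.circleAverage (fun z ↦ (2 : ℝ) ^ p • (‖φ z‖ ^ p + ‖b‖ ^ p)) 0 r := by
          refine Real.circleAverage_mono
            (circleIntegrable_of_continuousOn_ball (hhd.continuousOn.norm.pow 2) hr)
            (circleIntegrable_of_continuousOn_ball hc hr) fun z hz ↦ ?_
          have hz' : ‖z‖ = r := by simpa [abs_of_pos hr.1] using hz
          rw [hhp z (by rw [mem_ball_zero_iff, hz']; exact hr.2), smul_eq_mul]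
          simpa [sub_eq_add_neg] using norm_add_rpow_le hp.le (φ z) (-b)
      _ = 2 ^ p * (Real.circleAverage (fun z ↦ ‖φ z‖ ^ p) 0 r + ‖b‖ ^ p) := by
          rw [Real.circleAverage_fun_smul, smul_eq_mul,
            Real.circleAverage_fun_add (circleIntegrable_of_continuousOn_ball hφp hr)
              (circleIntegrable_const _ _ _), Real.circleAverage_const]
      _ ≤ _ := by
          gcongr
          simpa [Real.circleAverage, circleMap] using hM r hr
  intro w hw
  obtain ⟨z, hz, rfl⟩ := hφbij.surjOn hw
  refine le_of_forall_pos_le_add fun ε hε ↦ ?_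
  set K' := K + ε with hK'def
  have hK' : 0 < K' := by positivity
  set g : ℂ → ℂ := fun z ↦ f (φ z) / K' with hgdef
  have hnorm (z : ℂ) : ‖g z‖ = ‖f (φ z)‖ / K' := by
    simp only [hgdef, norm_div, Complex.norm_real, Real.norm_of_nonneg hK'.le]
  have hg : DifferentiableOn ℂ g (ball 0 1) := (hf.comp hφdiff hφbij.mapsTo).div_const _
  suffices hle : ‖g z‖ ≤ 1 by rwa [hnorm, div_le_one hK'] at hle
  refine norm_le_one_of_circleAverage_posLog_le hg (fun η hη ↦ exists_circleAverage_posLog_le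
    hg.continuousOn hhd hhM (A := Real.posLog (C / K') + C * 2 ^ p * (1 + ‖b‖ ^ p))
    (add_nonneg Real.posLog_nonneg (by positivity)) (fun z hz ↦ ?_) (fun R ↦ ?_) hη) z hz
  · have h1 : ‖φ z‖ ^ p ≤ 2 ^ p * (‖h z‖ ^ 2 + ‖b‖ ^ p) := by
      rw [hhp z hz]
      simpa using norm_add_rpow_le hp.le (φ z - b) b
    have h2 : ‖g z‖ ≤ C / K' * Real.exp (C * (2 ^ p * (‖h z‖ ^ 2 + ‖b‖ ^ p))) := by
      rw [hnorm, div_mul_eq_mul_div]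
      gcongr
      exact (hgrow _ (hφbij.mapsTo hz)).trans (by gcongr)
    have hb0 : 0 ≤ ‖b‖ ^ p := by positivity
    have hC2 : 0 ≤ C * 2 ^ p := by positivity
    have hP : 0 ≤ Real.posLog (C / K') := Real.posLog_nonneg
    have hq : 0 ≤ ‖h z‖ ^ 2 := by positivity
    calc Real.posLog ‖g z‖
        ≤ Real.posLog (C / K' * Real.exp (C * (2 ^ p * (‖h z‖ ^ 2 + ‖b‖ ^ p)))) :=
          Real.posLog_le_posLog (norm_nonneg _) h2
      _ ≤ Real.posLog (C / K') + Real.posLog (Real.exp (C * (2 ^ p * (‖h z‖ ^ 2 + ‖b‖ ^ p)))) :=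
          Real.posLog_mul
      _ = Real.posLog (C / K') + C * 2 ^ p * (‖h z‖ ^ 2 + ‖b‖ ^ p) := by
          rw [Real.posLog_apply (x := Real.exp _), Real.log_exp, max_eq_right (by positivity),
            mul_assoc C]
      _ ≤ _ := by
          have e1 : Real.posLog (C / K') ≤ Real.posLog (C / K') * (1 + ‖h z‖ ^ 2) :=
            le_mul_of_one_le_right hP (by linarith)
          have e2 : ‖h z‖ ^ 2 + ‖b‖ ^ p ≤ (1 + ‖b‖ ^ p) * (1 + ‖h z‖ ^ 2) := by nlinarith
          nlinarith [mul_le_mul_of_nonneg_left e2 hC2]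
  · obtain ⟨r₁, hr₁, hr₁'⟩ := exists_forall_lt_norm_notMem hφdiff hφbij.injOn
      (isCompact_setOf_norm_sub_le_of_le_norm hWopen hf.continuousOn (by linarith : K < K') hbd b
        ((R ^ 2) ^ p⁻¹)) (fun w hw ↦ hφbij.surjOn hw.1)
    refine ⟨r₁, hr₁, fun z hz hrz hR ↦ ?_⟩
    have hn := hr₁' z hz hrz
    rw [hnorm, div_le_one hK']
    by_contra! hlt
    refine hn ⟨hφbij.mapsTo hz, ?_, hlt.le⟩
    rw [Real.le_rpow_inv_iff_of_pos (norm_nonneg _) (by positivity) hp, ← hhp z hz]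
    gcongr
end

section
/- Let W ⊊ ℂ be a domain, a ∈ W, and φ_a : 𝔻 → W a conformal map with φ_a(0) = a and finite Hardy norm ‖φ_a‖_{H^p} < ∞ for some p > 0. If u is continuous on the closure of W, subharmonic on W, satisfies u ≤ K on ∂W, and u(z) ≤ C|z|^p + C on W for some constant C, then u(z) ≤ K for all z ∈ W. -/
open Complex Metric Set Filter Topology

/-- A function is subharmonic on `s` if it is upper semicontinuous on `s`
and satisfies the sub-mean-value inequality on every closed disk in `s`. -/
def SubharmonicOn (u : ℂ → ℝ) (s : Set ℂ) : Prop :=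
  UpperSemicontinuousOn u s ∧
    ∀ c ∈ s, ∀ R : ℝ, 0 < R → closedBall c R ⊆ s →
      u c ≤ (1/(2*Real.pi)) * ∫ θ in (0:ℝ)..(2*Real.pi),
        u (c + (R:ℂ) * Complex.exp (θ * Complex.I))

theorem circleIntegrable_of_continuousOn_ball_s1 {g : ℂ → ℝ} {R r : ℝ}
    (hg : ContinuousOn g (ball 0 R)) (hr0 : 0 ≤ r) (hr : r < R) : CircleIntegrable g 0 r :=
  (hg.mono fun z hz => by
    rw [mem_sphere_zero_iff_norm] at hz
    rwa [mem_ball_zero_iff, hz]).circleIntegrable hr0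

theorem circleAverage_sq_norm_sum (a : ℕ → ℂ) (r : ℝ) (k : ℕ) :
    Real.circleAverage (fun z => ‖∑ n ∈ Finset.range k, a n * z ^ n‖ ^ 2) 0 r =
      ∑ n ∈ Finset.range k, (‖a n‖ * |r| ^ n) ^ 2 := by
  classical
  let P : Polynomial ℂ := ∑ n ∈ Finset.range k, Polynomial.monomial n (a n * (r : ℂ) ^ n)
  have hcoeff : ∀ n, P.coeff n = if n ∈ Finset.range k then a n * (r : ℂ) ^ n else 0 := by
    intro n
    simp [P, Polynomial.finsetSum_coeff, Polynomial.coeff_monomial]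
  have h := P.sum_sq_norm_coeff_eq_circleAverage
  have hsum : ∑ i ∈ P.support, ‖P.coeff i‖ ^ 2 =
      ∑ n ∈ Finset.range k, (‖a n‖ * |r| ^ n) ^ 2 := by
    rw [Finset.sum_subset (s₂ := Finset.range k)]
    · refine Finset.sum_congr rfl fun n hn => ?_
      rw [hcoeff, if_pos hn]
      simp
    · intro n hn
      by_contra hk
      rw [Polynomial.mem_support_iff, hcoeff, if_neg hk] at hn
      exact hn rfl
    · intro n _ hn
      rw [Polynomial.notMem_support_iff.mp hn]
      simp
  rw [← hsum, h, Real.circleAverage_eq_circleAverage_zero_one]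
  congr 1
  ext z
  simp [P, Polynomial.eval_finsetSum, mul_pow, mul_assoc]

/-- Parseval's identity for power series on a circle. -/
theorem hasSum_circleAverage_sq_norm {a : ℕ → ℂ} {g : ℂ → ℂ} {R r : ℝ}
    (hg : ∀ z ∈ ball (0 : ℂ) R, HasSum (fun n => a n * z ^ n) (g z))
    (hr0 : 0 ≤ r) (hr : r < R) :
    HasSum (fun n => (‖a n‖ * r ^ n) ^ 2) (Real.circleAverage (fun z => ‖g z‖ ^ 2) 0 r) := by
  have hs : Summable fun n => ‖a n‖ * r ^ n := by
    have := (hg (r : ℂ) (by simpa [abs_of_nonneg hr0] using hr)).summable.norm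
    simpa [abs_of_nonneg hr0] using this
  rw [hasSum_iff_tendsto_nat_of_nonneg (fun n => by positivity)]
  have key : Tendsto (fun k : ℕ => Real.circleAverage
      (fun z => ‖∑ n ∈ Finset.range k, a n * z ^ n‖ ^ 2) 0 r) atTop
      (𝓝 (Real.circleAverage (fun z => ‖g z‖ ^ 2) 0 r)) := by
    unfold Real.circleAverage
    refine Tendsto.const_smul ?_ _
    refine intervalIntegral.tendsto_integral_filter_of_dominated_convergence
      (fun _ => (∑' n, ‖a n‖ * r ^ n) ^ 2) ?_ ?_ (by simp) ?_
    · refine Eventually.of_forall fun k => Continuous.aestronglyMeasurable ?_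
      fun_prop
    · refine Eventually.of_forall fun k => Eventually.of_forall fun θ _ => ?_
      rw [Real.norm_of_nonneg (by positivity)]
      refine pow_le_pow_left₀ (norm_nonneg _) ?_ 2
      refine (norm_sum_le _ _).trans ?_
      refine le_trans (Finset.sum_le_sum fun n _ => ?_) (hs.sum_le_tsum _ fun n _ => by positivity)
      simp [abs_of_nonneg hr0]
    · refine Eventually.of_forall fun θ _ => ?_
      have := (hg (circleMap 0 r θ) (by simpa [abs_of_nonneg hr0] using hr)).tendsto_sum_nat
      exact (this.norm).pow 2
  refine key.congr fun k => ?_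
  rw [circleAverage_sq_norm_sum, abs_of_nonneg hr0]

/-- Continuous functions on a circle are uniform limits of real parts of entire functions. -/
theorem exists_differentiable_re_approx {f : ℂ → ℝ} {r ε : ℝ} (hr : 0 < r) (hε : 0 < ε)
    (hf : ContinuousOn f (sphere 0 r)) :
    ∃ P : ℂ → ℂ, Differentiable ℂ P ∧ ∀ z ∈ sphere (0 : ℂ) r, |(P z).re - f z| ≤ ε := by
  have : Fact (0 < 2 * Real.pi) := ⟨Real.two_pi_pos⟩
  let γ : AddCircle (2 * Real.pi) → ℂ := fun x => (r : ℂ) * (AddCircle.toCircle x : ℂ)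
  have hγc : Continuous γ :=
    continuous_const.mul (continuous_subtype_val.comp AddCircle.continuous_toCircle)
  have hγs : ∀ x, γ x ∈ sphere (0 : ℂ) r := fun x => by
    simp only [γ, mem_sphere_zero_iff_norm, norm_mul, Circle.norm_coe, norm_real, Real.norm_eq_abs,
      abs_of_pos hr, mul_one]
  let F : C(AddCircle (2 * Real.pi), ℂ) :=
    ⟨fun x => (f (γ x) : ℂ), continuous_ofReal.comp (hf.comp_continuous hγc hγs)⟩
  have hF : F ∈ closure (Submodule.span ℂ (range (fourier (T := 2 * Real.pi))) :
      Set C(AddCircle (2 * Real.pi), ℂ)) := by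
    rw [← Submodule.topologicalClosure_coe, span_fourier_closure_eq_top]
    trivial
  obtain ⟨q, hq, hFq⟩ := Metric.mem_closure_iff.mp hF ε hε
  have hpoly : ∀ q ∈ Submodule.span ℂ (range (fourier (T := 2 * Real.pi))),
      ∃ P Q : ℂ → ℂ, Differentiable ℂ P ∧ Differentiable ℂ Q ∧
        ∀ x, q x = P (γ x) + starRingEnd ℂ (Q (γ x)) := by
    intro q hq
    induction hq using Submodule.span_induction with
    | mem q hq =>
      obtain ⟨n, rfl⟩ := hq
      have hdiv : ∀ x, γ x / r = (AddCircle.toCircle x : ℂ) := fun x =>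
        mul_div_cancel_left₀ _ (by exact_mod_cast hr.ne')
      rcases Int.eq_nat_or_neg n with ⟨m, rfl | rfl⟩
      · refine ⟨fun z => (z / r) ^ m, 0, by fun_prop, differentiable_const _, fun x => ?_⟩
        simp [hdiv, fourier_apply, AddCircle.toCircle_nsmul]
      · refine ⟨0, fun z => (z / r) ^ m, differentiable_const _, by fun_prop, fun x => ?_⟩
        rw [fourier_neg]
        simp [hdiv, fourier_apply, AddCircle.toCircle_nsmul]
    | zero => exact ⟨0, 0, differentiable_const _, differentiable_const _, by simp⟩
    | add q₁ q₂ _ _ h₁ h₂ =>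
      obtain ⟨P₁, Q₁, hP₁, hQ₁, h₁⟩ := h₁
      obtain ⟨P₂, Q₂, hP₂, hQ₂, h₂⟩ := h₂
      refine ⟨P₁ + P₂, Q₁ + Q₂, hP₁.add hP₂, hQ₁.add hQ₂, fun x => ?_⟩
      simp only [ContinuousMap.add_apply, h₁, h₂, Pi.add_apply, map_add]
      ring
    | smul c q _ h =>
      obtain ⟨P, Q, hP, hQ, h⟩ := h
      refine ⟨fun z => c * P z, fun z => starRingEnd ℂ c * Q z, hP.const_mul _,
        hQ.const_mul _, fun x => ?_⟩
      simp only [ContinuousMap.smul_apply, h, smul_eq_mul, map_mul, conj_conj]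
      ring
  obtain ⟨P, Q, hP, hQ, hPQ⟩ := hpoly q hq
  refine ⟨P + Q, hP.add hQ, fun z hz => ?_⟩
  obtain ⟨x, rfl⟩ : ∃ x, γ x = z := by
    refine ⟨(arg z : ℝ), ?_⟩
    rw [mem_sphere_zero_iff_norm] at hz
    have := norm_mul_exp_arg_mul_I z
    rw [hz] at this
    simp only [γ, AddCircle.toCircle_apply_mk, Circle.coe_exp]
    rw [div_self Real.two_pi_pos.ne', one_mul]
    exact this
  have h1 : ((P + Q) (γ x)).re = (q x).re := by simp [hPQ]
  have h2 : f (γ x) = (F x).re := by simp [F]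
  rw [h1, h2, ← sub_re]
  refine (abs_re_le_norm _).trans ?_
  rw [← dist_eq_norm, dist_comm]
  exact (ContinuousMap.dist_apply_le_dist x).trans hFq.le

/-- The maximum principle, for functions satisfying the sub-mean-value property on small circles. -/
theorem le_of_submean_of_frontier {V : Set ℂ} (hV : IsOpen V) (hVb : Bornology.IsBounded V)
    {f : ℂ → ℝ} (hf : ContinuousOn f (closure V)) {M : ℝ} (hM : ∀ z ∈ frontier V, f z ≤ M)
    (hsub : ∀ c ∈ V, ∀ R > 0, closedBall c R ⊆ V → f c ≤ Real.circleAverage f c R) :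
    ∀ z ∈ V, f z ≤ M := by
  by_contra! ⟨z, hz, hzM⟩
  have hK : IsCompact (closure V) := hVb.isCompact_closure
  obtain ⟨x, hx, hxmax⟩ := hK.exists_isMaxOn ⟨z, subset_closure hz⟩ hf
  have hMx : M < f x := hzM.trans_le (hxmax (subset_closure hz))
  have hE : IsCompact (closure V ∩ f ⁻¹' {f x}) :=
    hK.of_isClosed_subset (hf.preimage_isClosed_of_isClosed isClosed_closure isClosed_singleton)
      inter_subset_left
  obtain ⟨c, ⟨hcV, hcx⟩, hcmax⟩ := hE.exists_isMaxOn ⟨x, hx, rfl⟩ continuous_re.continuousOn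
  have hcx : f c = f x := hcx
  have hc : c ∈ V := by
    by_contra hcn
    have := hM c (by rw [hV.frontier_eq]; exact ⟨hcV, hcn⟩)
    linarith
  obtain ⟨R, hR, hRV⟩ := nhds_basis_closedBall.mem_iff.mp (hV.mem_nhds hc)
  have hle : ∀ w ∈ closedBall c R, f w ≤ f c := fun w hw =>
    hcx ▸ hxmax (subset_closure (hRV hw))
  have hcm : ∀ θ, circleMap c R θ ∈ closedBall c R := fun θ => circleMap_mem_closedBall c hR.le θ
  have hlt : f (circleMap c R 0) < f c := by
    refine lt_of_le_of_ne (hle _ (hcm 0)) fun h => ?_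
    have := hcmax (show circleMap c R 0 ∈ closure V ∩ f ⁻¹' {f x} from
      ⟨subset_closure (hRV (hcm 0)), h.trans hcx⟩)
    simp [circleMap] at this
    linarith
  have hcont : Continuous fun θ => f (circleMap c R θ) :=
    (hf.mono (hRV.trans subset_closure)).comp_continuous (continuous_circleMap c R) hcm
  have integral_lt : ∫ θ in (0 : ℝ)..(2 * Real.pi), f (circleMap c R θ) <
      ∫ _ in (0 : ℝ)..(2 * Real.pi), f c :=
    intervalIntegral.integral_lt_integral_of_continuousOn_of_le_of_exists_lt Real.two_pi_pos
      hcont.continuousOn continuousOn_const (fun θ _ => hle _ (hcm θ))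
      ⟨0, ⟨le_rfl, Real.two_pi_pos.le⟩, hlt⟩
  have h2 := hsub c hc R hR hRV
  rw [← Real.circleAverage_const (f c) c R] at h2
  exact absurd h2 (not_le.mpr (mul_lt_mul_of_pos_left integral_lt (inv_pos.mpr Real.two_pi_pos)))

theorem not_eventually_const_of_injOn {f : ℂ → ℂ} {U : Set ℂ} (hU : IsOpen U)
    (hinj : InjOn f U) {z : ℂ} (hz : z ∈ U) : ¬ ∀ᶠ w in 𝓝 z, f w = f z := by
  intro h
  have : ∀ᶠ w in 𝓝[≠] z, False := by
    filter_upwards [nhdsWithin_le_nhds h, nhdsWithin_le_nhds (hU.mem_nhds hz),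
      self_mem_nhdsWithin] with w hw hwU hne
    exact hne (hinj hwU hz hw)
  rw [eventually_false_iff_eq_bot] at this
  exact (NormedField.nhdsNE_neBot z).ne this

theorem nhds_le_map_nhds_of_injOn {f : ℂ → ℂ} {U : Set ℂ} (hU : IsOpen U)
    (hf : DifferentiableOn ℂ f U) (hinj : InjOn f U) {z : ℂ} (hz : z ∈ U) :
    𝓝 (f z) ≤ map f (𝓝 z) :=
  (hf.analyticOnNhd hU z hz).eventually_constant_or_nhds_le_map_nhds.resolve_left
    (not_eventually_const_of_injOn hU hinj hz)

theorem isOpen_image_of_injOn {f : ℂ → ℂ} {U s : Set ℂ} (hU : IsOpen U)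
    (hf : DifferentiableOn ℂ f U) (hinj : InjOn f U) (hs : IsOpen s) (hsU : s ⊆ U) :
    IsOpen (f '' s) := by
  rw [isOpen_iff_mem_nhds]
  rintro _ ⟨z, hz, rfl⟩
  exact nhds_le_map_nhds_of_injOn hU hf hinj (hsU hz) (image_mem_map (hs.mem_nhds hz))

/-- The inverse of an injective holomorphic function is holomorphic. -/
theorem differentiableOn_of_leftInvOn {f τ : ℂ → ℂ} {U : Set ℂ} (hU : IsOpen U)
    (hf : DifferentiableOn ℂ f U) (hτ : LeftInvOn τ f U) : DifferentiableOn ℂ τ (f '' U) := by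
  have hinj : InjOn f U := hτ.injOn
  have hcont : ∀ z ∈ U, Tendsto τ (𝓝 (f z)) (𝓝 z) := by
    intro z hz
    refine Tendsto.mono_left ?_ (nhds_le_map_nhds_of_injOn hU hf hinj hz)
    rw [tendsto_map'_iff]
    refine tendsto_id.congr' ?_
    filter_upwards [hU.mem_nhds hz] with w hw
    exact (hτ hw).symm
  have hopen := isOpen_image_of_injOn hU hf hinj hU subset_rfl
  rintro _ ⟨z, hz, rfl⟩
  have hderiv : ∀ᶠ w in 𝓝[≠] z, deriv f w ≠ 0 := by
    refine ((hf.analyticOnNhd hU z hz).deriv.eventually_eq_zero_or_eventually_ne_zero).resolve_left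
      fun h => not_eventually_const_of_injOn hU hinj hz ?_
    obtain ⟨R, hR, hRs⟩ := Metric.eventually_nhds_iff_ball.mp (h.and (hU.mem_nhds hz))
    filter_upwards [ball_mem_nhds z hR] with w hw
    exact isOpen_ball.is_const_of_deriv_eq_zero (convex_ball z R).isPreconnected
      (hf.mono fun y hy => (hRs y hy).2) (fun y hy => (hRs y hy).1) hw (mem_ball_self hR)
  have hpunct : Tendsto τ (𝓝[≠] (f z)) (𝓝[≠] z) := by
    refine tendsto_nhdsWithin_iff.mpr ⟨(hcont z hz).mono_left nhdsWithin_le_nhds, ?_⟩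
    filter_upwards [nhdsWithin_le_nhds (hopen.mem_nhds (mem_image_of_mem f hz)),
      self_mem_nhdsWithin]
    rintro _ ⟨y, hy, rfl⟩ hne h
    rw [mem_singleton_iff, hτ hy] at h
    exact hne (h ▸ rfl)
  refine (analyticAt_of_differentiable_on_punctured_nhds_of_continuousAt ?_
    ?_).differentiableAt.differentiableWithinAt
  · filter_upwards [hpunct.eventually hderiv,
      nhdsWithin_le_nhds (hopen.mem_nhds (mem_image_of_mem f hz))]
    rintro _ hne ⟨y, hy, rfl⟩
    have hτy := hτ hy
    rw [hτy] at hne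
    refine (HasDerivAt.of_local_left_inverse (f := f) (f' := deriv f y) ?_ ?_ hne ?_).differentiableAt
    · rw [ContinuousAt, hτy]
      exact hcont y hy
    · rw [hτy]
      exact (hf.differentiableAt (hU.mem_nhds hy)).hasDerivAt
    · filter_upwards [hopen.mem_nhds (mem_image_of_mem f hy)]
      rintro _ ⟨x, hx, rfl⟩
      rw [hτ hx]
  · rw [ContinuousAt, hτ hz]
    exact hcont z hz

theorem circleAverage_re {P : ℂ → ℂ} {U : Set ℂ} {c : ℂ} {R : ℝ} (hR : 0 ≤ R)
    (hP : DifferentiableOn ℂ P U) (hU : closedBall c R ⊆ U) :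
    Real.circleAverage (fun z => (P z).re) c R = (P c).re := by
  have h := DiffContOnCl.circleAverage (R := R) (f := P) (c := c)
    (by rw [abs_of_nonneg hR]; exact hP.diffContOnCl_ball hU)
  have hi : CircleIntegrable P c R :=
    (hP.continuousOn.mono (sphere_subset_closedBall.trans hU)).circleIntegrable hR
  have h2 := reCLM.circleAverage_comp_comm hi
  rw [h] at h2
  exact h2

/-- Circle means of a subharmonic function pulled back by a conformal map are nondecreasing in the
radius. -/
theorem circleAverage_comp_mono {φ : ℂ → ℂ} {v : ℂ → ℝ} {R₀ s r : ℝ}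
    (hφ : DifferentiableOn ℂ φ (ball 0 R₀)) (hinj : InjOn φ (ball 0 R₀))
    (hv : ContinuousOn v (φ '' ball 0 R₀))
    (hsub : ∀ c ∈ φ '' ball 0 R₀, ∀ R > 0, closedBall c R ⊆ φ '' ball 0 R₀ →
      v c ≤ Real.circleAverage v c R)
    (hs : 0 ≤ s) (hsr : s < r) (hr : r < R₀) :
    Real.circleAverage (v ∘ φ) 0 s ≤ Real.circleAverage (v ∘ φ) 0 r := by
  have hr0 : 0 < r := hs.trans_lt hsr
  have hψ : ContinuousOn (v ∘ φ) (ball 0 R₀) :=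
    hv.comp hφ.continuousOn (mapsTo_image _ _)
  have hsphere : ∀ {t : ℝ}, t < R₀ → sphere (0 : ℂ) t ⊆ ball 0 R₀ := fun ht z hz =>
    mem_ball.mpr ((mem_sphere.mp hz).trans_lt ht)
  refine le_of_forall_pos_le_add fun ε hε => ?_
  obtain ⟨P, hP, hPε⟩ := exists_differentiable_re_approx hr0 (half_pos hε) (hψ.mono (hsphere hr))
  set τ := Function.invFunOn φ (ball 0 R₀)
  have hτ : LeftInvOn τ φ (ball 0 R₀) := hinj.leftInvOn_invFunOn
  have hτd := differentiableOn_of_leftInvOn isOpen_ball hφ hτ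
  have hbr : ball (0 : ℂ) r ⊆ ball 0 R₀ := ball_subset_ball hr.le
  have hcr : closedBall (0 : ℂ) r ⊆ ball 0 R₀ := closedBall_subset_ball hr
  have hVo : IsOpen (φ '' ball 0 r) := isOpen_image_of_injOn isOpen_ball hφ hinj isOpen_ball hbr
  have hcomp : IsCompact (φ '' closedBall 0 r) :=
    (isCompact_closedBall 0 r).image_of_continuousOn (hφ.continuousOn.mono hcr)
  have hcl : closure (φ '' ball 0 r) ⊆ φ '' closedBall 0 r :=
    closure_minimal (image_mono ball_subset_closedBall) hcomp.isClosed
  have hPτ : DifferentiableOn ℂ (P ∘ τ) (φ '' ball 0 R₀) :=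
    hP.comp_differentiableOn hτd
  have hmax : ∀ w ∈ φ '' ball 0 r, v w - (P (τ w)).re ≤ ε / 2 := by
    refine le_of_submean_of_frontier hVo
      (hcomp.isBounded.subset (image_mono ball_subset_closedBall)) ?_ ?_ ?_
    · refine ContinuousOn.mono ?_ (hcl.trans (image_mono hcr))
      exact hv.sub (continuous_re.comp_continuousOn hPτ.continuousOn)
    · intro w hw
      rw [hVo.frontier_eq] at hw
      obtain ⟨z, hz, rfl⟩ := hcl hw.1
      have hzs : z ∈ sphere (0 : ℂ) r := by
        rw [← closedBall_sdiff_ball]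
        exact ⟨hz, fun h => hw.2 (mem_image_of_mem φ h)⟩
      rw [hτ (hcr hz)]
      have := (abs_le.mp (hPε z hzs)).1
      simp only [Function.comp] at this
      linarith
    · intro c hc R hR hRV
      have hRW := hRV.trans (image_mono hbr)
      have h1 := hsub c (image_mono hbr hc) R hR hRW
      have h2 := circleAverage_re hR.le hPτ hRW
      have h3 := Real.circleAverage_fun_sub (f₁ := v) (f₂ := fun w => (P (τ w)).re) (c := c) (R := R)
        ((hv.mono (sphere_subset_closedBall.trans hRW)).circleIntegrable hR.le)
        (((continuous_re.comp_continuousOn hPτ.continuousOn).mono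
          (sphere_subset_closedBall.trans hRW)).circleIntegrable hR.le)
      simp only [Function.comp] at h2
      rw [h3, h2]
      linarith
  have hPint : ∀ (t δ : ℝ), 0 ≤ t →
      Real.circleAverage (fun z => (P z + (δ : ℂ)).re) 0 t = (P 0).re + δ := by
    intro t δ ht
    rw [circleAverage_re ht (hP.add_const _).differentiableOn (subset_univ _)]
    simp
  have hPci : ∀ (t δ : ℝ), 0 ≤ t → CircleIntegrable (fun z => (P z + (δ : ℂ)).re) 0 t := by
    intro t δ ht
    exact (continuous_re.comp (hP.continuous.add continuous_const)).continuousOn.circleIntegrable ht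
  have h1 : Real.circleAverage (v ∘ φ) 0 s ≤ (P 0).re + ε / 2 := by
    rw [← hPint s _ hs]
    refine Real.circleAverage_mono (circleIntegrable_of_continuousOn_ball_s1 hψ hs (hsr.trans hr))
      (hPci s _ hs) fun z hz => ?_
    rw [abs_of_nonneg hs, mem_sphere_zero_iff_norm] at hz
    have hzr : z ∈ ball (0 : ℂ) r := by rwa [mem_ball_zero_iff, hz]
    have := hmax (φ z) (mem_image_of_mem φ hzr)
    rw [hτ (hbr hzr)] at this
    simp only [Function.comp, add_re, ofReal_re]
    linarith
  have h2 : (P 0).re + -(ε / 2) ≤ Real.circleAverage (v ∘ φ) 0 r := by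
    rw [← hPint r _ hr0.le]
    refine Real.circleAverage_mono (hPci r _ hr0.le)
      (circleIntegrable_of_continuousOn_ball_s1 hψ hr0.le hr) fun z hz => ?_
    rw [abs_of_nonneg hr0.le] at hz
    have := (abs_le.mp (hPε z hz)).2
    simp only [Function.comp, add_re, ofReal_re] at this ⊢
    linarith
  linarith

/-- A function in the Hardy space `H²` is a bounded function plus one of small norm. -/
theorem exists_bounded_add_small_of_hardy {g : ℂ → ℂ} {M δ : ℝ}
    (hg : DifferentiableOn ℂ g (ball 0 1))
    (hM : ∀ r ∈ Ioo (0 : ℝ) 1, Real.circleAverage (fun z => ‖g z‖ ^ 2) 0 r ≤ M) (hδ : 0 < δ) :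
    ∃ (B : ℝ) (h : ℂ → ℂ), ContinuousOn h (ball 0 1) ∧ (∀ z ∈ ball (0 : ℂ) 1, ‖g z - h z‖ ≤ B) ∧
      ∀ r ∈ Ioo (0 : ℝ) 1, Real.circleAverage (fun z => ‖h z‖ ^ 2) 0 r ≤ δ := by
  set a : ℕ → ℂ := fun n => (n.factorial : ℂ)⁻¹ * iteratedDeriv n g 0 with ha
  have hsum : ∀ z ∈ ball (0 : ℂ) 1, HasSum (fun n => a n * z ^ n) (g z) := by
    intro z hz
    convert! hasSum_taylorSeries_on_ball hg hz using 2 with n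
    simp only [ha, sub_zero, smul_eq_mul]
    ring
  have hle : ∀ k, ∑ n ∈ Finset.range k, ‖a n‖ ^ 2 ≤ M := by
    intro k
    have ht : Tendsto (fun r : ℝ => ∑ n ∈ Finset.range k, (‖a n‖ * r ^ n) ^ 2) (𝓝[<] 1)
        (𝓝 (∑ n ∈ Finset.range k, (‖a n‖ * 1 ^ n) ^ 2)) :=
      (Continuous.tendsto (by fun_prop) 1).mono_left nhdsWithin_le_nhds
    simp only [one_pow, mul_one] at ht
    refine le_of_tendsto ht ?_
    filter_upwards [Ioo_mem_nhdsLT (zero_lt_one' ℝ)] with r hr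
    exact (sum_le_hasSum _ (fun n _ => by positivity)
      (hasSum_circleAverage_sq_norm hsum hr.1.le hr.2)).trans (hM r hr)
  have hsq : Summable fun n => ‖a n‖ ^ 2 := summable_of_sum_range_le (fun n => by positivity) hle
  obtain ⟨N, hN⟩ := ((tendsto_sum_nat_add fun n => ‖a n‖ ^ 2).eventually
    (ge_mem_nhds hδ)).exists
  set T : ℂ → ℂ := fun z => ∑ n ∈ Finset.range N, a n * z ^ n with hT
  set b : ℕ → ℂ := fun n => if n < N then 0 else a n with hb
  have hbsum : ∀ z ∈ ball (0 : ℂ) 1, HasSum (fun n => b n * z ^ n) (g z - T z) := by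
    intro z hz
    have h1 : HasSum (fun n => if n ∈ Finset.range N then a n * z ^ n else 0) (T z) := by
      have := hasSum_sum_of_ne_finset_zero (s := Finset.range N)
        (f := fun n => if n ∈ Finset.range N then a n * z ^ n else 0)
        (L := SummationFilter.unconditional ℕ) (fun n hn => if_neg hn)
      rwa [Finset.sum_congr rfl fun n hn => if_pos hn] at this
    convert! (hsum z hz).sub h1 using 2 with n
    by_cases hn : n < N <;> simp [hb, hn]
  have hbsq : Summable fun n => ‖b n‖ ^ 2 :=
    hsq.of_nonneg_of_le (fun n => by positivity) fun n => by
      by_cases hn : n < N <;> simp [hb, hn]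
  have htail : ∑' n, ‖b n‖ ^ 2 ≤ δ := by
    rw [← hbsq.sum_add_tsum_nat_add N, Finset.sum_eq_zero, zero_add]
    · simpa [hb] using hN
    · intro n hn
      simp [hb, Finset.mem_range.mp hn]
  refine ⟨∑ n ∈ Finset.range N, ‖a n‖, fun z => g z - T z,
    hg.continuousOn.sub (Continuous.continuousOn (by fun_prop)), fun z hz => ?_, fun r hr => ?_⟩
  · rw [sub_sub_cancel]
    refine (norm_sum_le _ _).trans (Finset.sum_le_sum fun n _ => ?_)
    rw [norm_mul, norm_pow]
    exact mul_le_of_le_one_right (norm_nonneg _)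
      (pow_le_one₀ (norm_nonneg _) (mem_ball_zero_iff.mp hz).le)
  · refine (hasSum_le (fun n => ?_) (hasSum_circleAverage_sq_norm hbsum hr.1.le hr.2)
      hbsq.hasSum).trans htail
    have h1 : r ^ n ≤ 1 := pow_le_one₀ hr.1.le hr.2.le
    have h0 : 0 ≤ r ^ n := pow_nonneg hr.1.le n
    exact pow_le_pow_left₀ (by positivity) (mul_le_of_le_one_right (norm_nonneg _) h1) 2

/-- A nonvanishing holomorphic function on a disk has a holomorphic logarithm. -/
theorem exists_exp_eq_on_ball {F : ℂ → ℂ} {c : ℂ} {R : ℝ} (hR : 0 < R)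
    (hF : DifferentiableOn ℂ F (ball c R)) (hF0 : ∀ z ∈ ball c R, F z ≠ 0) :
    ∃ L : ℂ → ℂ, DifferentiableOn ℂ L (ball c R) ∧ ∀ z ∈ ball c R, exp (L z) = F z := by
  have hd : DifferentiableOn ℂ (fun z => deriv F z / F z) (ball c R) :=
    (hF.deriv isOpen_ball).div hF hF0
  obtain ⟨L, hLc, hL⟩ := hd.isExactOn_ball.with_val_at c (log (F c))
  have hFd : ∀ z ∈ ball c R, HasDerivAt F (deriv F z) z := fun z hz =>
    (hF.differentiableAt (isOpen_ball.mem_nhds hz)).hasDerivAt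
  have hq : ∀ z ∈ ball c R, HasDerivAt (fun z => F z * exp (-L z)) 0 z := by
    intro z hz
    convert! (hFd z hz).mul (hL z hz).neg.cexp using 1
    have := hF0 z hz
    field_simp
    ring
  refine ⟨L, fun z hz => (hL z hz).differentiableAt.differentiableWithinAt, fun z hz => ?_⟩
  have h := isOpen_ball.is_const_of_deriv_eq_zero (convex_ball c R).isPreconnected
    (fun y hy => (hq y hy).differentiableAt.differentiableWithinAt)
    (fun y hy => (hq y hy).deriv) hz (mem_ball_self hR)
  simp only [hLc, exp_neg] at h
  rw [exp_log (hF0 c (mem_ball_self hR)), mul_inv_cancel₀ (hF0 c (mem_ball_self hR))] at h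
  field_simp at h
  exact h.symm

/-- Powers of the modulus of a nonvanishing holomorphic function are squares of moduli of
holomorphic functions. -/
theorem exists_sq_norm_eq_rpow {F : ℂ → ℂ} {c : ℂ} {R : ℝ} (hR : 0 < R)
    (hF : DifferentiableOn ℂ F (ball c R)) (hF0 : ∀ z ∈ ball c R, F z ≠ 0) (p : ℝ) :
    ∃ g : ℂ → ℂ, DifferentiableOn ℂ g (ball c R) ∧
      ∀ z ∈ ball c R, ‖g z‖ ^ 2 = ‖F z‖ ^ p := by
  obtain ⟨L, hL, hLF⟩ := exists_exp_eq_on_ball hR hF hF0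
  refine ⟨fun z => exp ((p / 2 : ℝ) * L z), (hL.const_mul _).cexp, fun z hz => ?_⟩
  rw [← hLF z hz, norm_exp, norm_exp, re_ofReal_mul, ← Real.exp_mul, ← Real.exp_nat_mul]
  congr 1
  push_cast
  ring

theorem rpow_add_le {x y p : ℝ} (hx : 0 ≤ x) (hy : 0 ≤ y) (hp : 0 ≤ p) :
    (x + y) ^ p ≤ 2 ^ p * (x ^ p + y ^ p) := by
  have hmax : max x y ^ p ≤ x ^ p + y ^ p := by
    rcases max_choice x y with h | h <;> rw [h]
    · exact le_add_of_nonneg_right (Real.rpow_nonneg hy p)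
    · exact le_add_of_nonneg_left (Real.rpow_nonneg hx p)
  calc (x + y) ^ p ≤ (2 * max x y) ^ p := by
        refine Real.rpow_le_rpow (by positivity) ?_ hp
        linarith [le_max_left x y, le_max_right x y]
    _ = 2 ^ p * max x y ^ p := Real.mul_rpow (by norm_num) (hx.trans (le_max_left _ _))
    _ ≤ _ := by gcongr

/-- A function continuous on the closure of a domain and bounded on its frontier is almost bounded by
the same constant at images of points near the unit circle, away from infinity. -/
theorem exists_radius_le_add_of_frontier {W : Set ℂ} {φ : ℂ → ℂ} {u : ℂ → ℝ} {K η : ℝ}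
    (hW : IsOpen W) (hφ : DifferentiableOn ℂ φ (ball 0 1)) (hbij : BijOn φ (ball 0 1) W)
    (hu : ContinuousOn u (closure W)) (hbd : ∀ z ∈ frontier W, u z ≤ K) (hη : 0 < η) (R : ℝ) :
    ∃ ρ < 1, ∀ z ∈ ball (0 : ℂ) 1, ρ < ‖z‖ → ‖φ z‖ ≤ R → u (φ z) ≤ K + η := by
  set τ := Function.invFunOn φ (ball 0 1)
  have hτ : LeftInvOn τ φ (ball 0 1) := hbij.injOn.leftInvOn_invFunOn
  have hτd := differentiableOn_of_leftInvOn isOpen_ball hφ hτ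
  rw [hbij.image_eq] at hτd
  set S : Set ℂ := closedBall 0 R ∩ (closure W ∩ u ⁻¹' Ici (K + η)) with hS
  have hSc : IsCompact S :=
    (isCompact_closedBall 0 R).inter_right
      (hu.preimage_isClosed_of_isClosed isClosed_closure isClosed_Ici)
  have hSW : S ⊆ W := by
    rintro w ⟨-, hwc, hwu⟩
    by_contra hw
    have h1 := hbd w (by rw [hW.frontier_eq]; exact ⟨hwc, hw⟩)
    have h2 : K + η ≤ u w := hwu
    linarith
  have hmem : ∀ z ∈ ball (0 : ℂ) 1, ‖φ z‖ ≤ R → K + η < u (φ z) → φ z ∈ S := fun z hz hR hlt =>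
    ⟨mem_closedBall_zero_iff.mpr hR, subset_closure (hbij.mapsTo hz), hlt.le⟩
  rcases S.eq_empty_or_nonempty with hne | hne
  · refine ⟨0, one_pos, fun z hz _ hR => ?_⟩
    by_contra! hlt
    exact (hne ▸ hmem z hz hR hlt : φ z ∈ (∅ : Set ℂ))
  · obtain ⟨w, hw, hmax⟩ := hSc.exists_isMaxOn hne (hτd.continuousOn.mono hSW).norm
    obtain ⟨z₀, hz₀, rfl⟩ := hbij.surjOn (hSW hw)
    refine ⟨‖z₀‖, mem_ball_zero_iff.mp hz₀, fun z hz hlt hR => ?_⟩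
    by_contra! hu'
    have h := hmax (hmem z hz hR hu')
    simp only [mem_ofPred_eq, hτ hz, hτ hz₀] at h
    linarith

/-- The positive part of a continuous subharmonic function satisfies the sub-mean-value property. -/
theorem SubharmonicOn.max_sub_le_circleAverage {u : ℂ → ℝ} {W : Set ℂ} (hu : SubharmonicOn u W)
    (hc : ContinuousOn u W) (K : ℝ) {c : ℂ} (hcW : c ∈ W) {R : ℝ} (hR : 0 < R)
    (hRW : closedBall c R ⊆ W) :
    max (u c - K) 0 ≤ Real.circleAverage (fun z => max (u z - K) 0) c R := by
  have hus : ContinuousOn u (sphere c R) := hc.mono (sphere_subset_closedBall.trans hRW)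
  refine max_le ?_ (Real.circleAverage_nonneg_of_nonneg fun z _ => le_max_right _ _)
  have h1 : u c ≤ Real.circleAverage u c R := by
    have h := hu.2 c hcW R hR hRW
    rwa [one_div] at h
  have h2 := Real.circleAverage_fun_sub (f₁ := u) (f₂ := fun _ => K) (c := c) (R := R)
    (hus.circleIntegrable hR.le) (continuousOn_const.circleIntegrable hR.le)
  rw [Real.circleAverage_const] at h2
  calc u c - K ≤ Real.circleAverage (fun z => u z - K) c R := by linarith
    _ ≤ _ := Real.circleAverage_mono ((hus.sub continuousOn_const).circleIntegrable hR.le)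
        (ContinuousOn.circleIntegrable hR.le (by fun_prop))
        fun z _ => le_max_left _ _

/-- A nonnegative continuous function on a disk whose circle means vanish is zero. -/
theorem eq_zero_of_circleAverage_nonpos {ψ : ℂ → ℝ} {z : ℂ} (hψ : ContinuousOn ψ (sphere 0 ‖z‖))
    (h0 : ∀ w ∈ sphere 0 ‖z‖, 0 ≤ ψ w) (hav : Real.circleAverage ψ 0 ‖z‖ ≤ 0) : ψ z ≤ 0 := by
  by_contra! hz
  have hmem : ∀ θ, circleMap 0 ‖z‖ θ ∈ sphere (0 : ℂ) ‖z‖ := fun θ => by simp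
  have hcont : Continuous fun θ => ψ (circleMap 0 ‖z‖ θ) :=
    hψ.comp_continuous (continuous_circleMap 0 ‖z‖) hmem
  obtain ⟨θ, hθ, hθz⟩ : ∃ θ ∈ Icc 0 (2 * Real.pi), circleMap 0 ‖z‖ θ = z := by
    obtain ⟨θ, hθ, h⟩ := (image_circleMap_Ioc 0 ‖z‖).symm ▸
      (show z ∈ sphere (0 : ℂ) |‖z‖| by simp)
    exact ⟨θ, Ioc_subset_Icc_self hθ, h⟩
  have integral_lt := intervalIntegral.integral_lt_integral_of_continuousOn_of_le_of_exists_lt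
    (f := fun _ => (0 : ℝ)) Real.two_pi_pos continuousOn_const hcont.continuousOn
    (fun θ _ => h0 _ (hmem θ)) ⟨θ, hθ, by rwa [hθz]⟩
  rw [intervalIntegral.integral_zero] at integral_lt
  exact absurd hav (not_le.mpr (mul_pos (inv_pos.mpr Real.two_pi_pos) integral_lt))

/-- the key lemma.  If the Riemann map of `W` has finite `H^p`
norm, a subharmonic function on `W`, continuous on its closure, bounded by `K`
on the boundary and growing at most like `C|z|^p + C`, is bounded by `K`. -/
theorem subharmonic_bound_of_hardy
    (W : Set ℂ) (hWopen : IsOpen W) (hWconn : IsConnected W) (hWne : W ≠ Set.univ)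
    (a : ℂ) (ha : a ∈ W)
    (φ : ℂ → ℂ) (hφdiff : DifferentiableOn ℂ φ (ball (0:ℂ) 1))
    (hφbij : Set.BijOn φ (ball (0:ℂ) 1) W) (hφ0 : φ 0 = a)
    (p : ℝ) (hp : 0 < p)
    (hHardy : ∃ M : ℝ, ∀ r ∈ Ioo (0:ℝ) 1,
      (1/(2*Real.pi)) * ∫ θ in (0:ℝ)..(2*Real.pi),
        ‖φ ((r:ℂ) * Complex.exp (θ * Complex.I))‖ ^ p ≤ M)
    (u : ℂ → ℝ) (hucont : ContinuousOn u (closure W))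
    (husub : SubharmonicOn u W)
    (K : ℝ) (hbd : ∀ z ∈ frontier W, u z ≤ K)
    (C : ℝ) (hgrow : ∀ z ∈ W, u z ≤ C * ‖z‖ ^ p + C) :
    ∀ z ∈ W, u z ≤ K := by
  obtain ⟨M, hM⟩ := hHardy
  obtain ⟨b, hb⟩ := (ne_univ_iff_exists_notMem W).mp hWne
  obtain ⟨g, hg, hgφ⟩ := exists_sq_norm_eq_rpow one_pos (hφdiff.sub_const b)
    (fun z hz h => hb (sub_eq_zero.mp h ▸ hφbij.mapsTo hz)) p
  have hgM : ∀ r ∈ Ioo (0 : ℝ) 1, Real.circleAverage (fun z => ‖g z‖ ^ 2) 0 r ≤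
      2 ^ p * (M + ‖b‖ ^ p) := by
    intro r hr
    have hφc : ContinuousOn (fun z => ‖φ z‖ ^ p) (ball 0 1) :=
      hφdiff.continuousOn.norm.rpow_const fun _ _ => Or.inr hp.le
    have hφi := circleIntegrable_of_continuousOn_ball_s1 hφc hr.1.le hr.2
    have hMr : Real.circleAverage (fun z => ‖φ z‖ ^ p) 0 r ≤ M := by
      have h := hM r hr
      rw [one_div] at h
      simpa [Real.circleAverage, circleMap] using h
    have hadd := Real.circleAverage_fun_add (f₁ := fun z => ‖φ z‖ ^ p) (f₂ := fun _ => ‖b‖ ^ p)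
      hφi (continuousOn_const.circleIntegrable hr.1.le)
    have hsmul := Real.circleAverage_fun_smul (𝕜 := ℝ) (a := (2 : ℝ) ^ p)
      (f := fun z => ‖φ z‖ ^ p + ‖b‖ ^ p) (c := 0) (R := r)
    rw [hadd, Real.circleAverage_const] at hsmul
    calc Real.circleAverage (fun z => ‖g z‖ ^ 2) 0 r
        ≤ Real.circleAverage (fun z => (2 : ℝ) ^ p • (‖φ z‖ ^ p + ‖b‖ ^ p)) 0 r := by
          refine Real.circleAverage_mono
            (circleIntegrable_of_continuousOn_ball_s1 (hg.continuousOn.norm.pow 2) hr.1.le hr.2)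
            (circleIntegrable_of_continuousOn_ball_s1
              (by fun_prop) hr.1.le hr.2) fun z hz => ?_
          rw [abs_of_pos hr.1, mem_sphere_zero_iff_norm] at hz
          rw [hgφ z (by rw [mem_ball_zero_iff, hz]; exact hr.2), smul_eq_mul]
          exact (Real.rpow_le_rpow (norm_nonneg _) (norm_sub_le _ _) hp.le).trans
            (rpow_add_le (norm_nonneg _) (norm_nonneg _) hp.le)
      _ = 2 ^ p * (Real.circleAverage (fun z => ‖φ z‖ ^ p) 0 r + ‖b‖ ^ p) := hsmul
      _ ≤ _ := by gcongr
  set D : ℝ := |C| * (2 ^ p * 2) + |C| + |K| with hD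
  have hD0 : 0 ≤ D := by positivity
  have hgrowg : ∀ z ∈ ball (0 : ℂ) 1, max 1 ‖b‖ ≤ ‖φ z - b‖ → u (φ z) - K ≤ D * ‖g z‖ ^ 2 := by
    intro z hz hle
    have h1 : 1 ≤ ‖φ z - b‖ ^ p := Real.one_le_rpow ((le_max_left _ _).trans hle) hp.le
    have h2 : ‖φ z‖ ^ p ≤ 2 ^ p * 2 * ‖φ z - b‖ ^ p := by
      have h3 : ‖b‖ ^ p ≤ ‖φ z - b‖ ^ p :=
        Real.rpow_le_rpow (norm_nonneg _) ((le_max_right _ _).trans hle) hp.le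
      calc ‖φ z‖ ^ p ≤ (‖φ z - b‖ + ‖b‖) ^ p := by
            refine Real.rpow_le_rpow (norm_nonneg _) ?_ hp.le
            simpa using norm_add_le (φ z - b) b
        _ ≤ 2 ^ p * (‖φ z - b‖ ^ p + ‖b‖ ^ p) :=
            rpow_add_le (norm_nonneg _) (norm_nonneg _) hp.le
        _ ≤ 2 ^ p * (‖φ z - b‖ ^ p + ‖φ z - b‖ ^ p) := by gcongr
        _ = _ := by ring
    have h4 := hgrow (φ z) (hφbij.mapsTo hz)
    have h5 : C * ‖φ z‖ ^ p ≤ |C| * (2 ^ p * 2 * ‖φ z - b‖ ^ p) :=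
      mul_le_mul (le_abs_self C) h2 (by positivity) (abs_nonneg C)
    have h6 : C ≤ |C| * ‖φ z - b‖ ^ p := (le_abs_self C).trans
      (le_mul_of_one_le_right (abs_nonneg C) h1)
    have h7 : -K ≤ |K| * ‖φ z - b‖ ^ p := (neg_le_abs K).trans
      (le_mul_of_one_le_right (abs_nonneg K) h1)
    rw [hgφ z hz, hD]
    linarith
  have huW : ContinuousOn u W := hucont.mono subset_closure
  have hv : ContinuousOn (fun z => max (u z - K) 0) W := by
    fun_prop
  have hψ : ContinuousOn ((fun z => max (u z - K) 0) ∘ φ) (ball 0 1) :=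
    hv.comp hφdiff.continuousOn hφbij.mapsTo
  have hmean : ∀ s ∈ Ico (0 : ℝ) 1,
      Real.circleAverage ((fun z => max (u z - K) 0) ∘ φ) 0 s ≤ 0 := by
    intro s hs
    refine le_of_forall_pos_le_add fun ε hε => ?_
    rw [zero_add]
    obtain ⟨B, h, hhc, hB, hh⟩ := exists_bounded_add_small_of_hardy
      (δ := ε / 2 / (4 * (D + 1))) hg hgM (by positivity)
    set T : ℝ := max (max 1 ‖b‖) ((4 * B ^ 2) ^ p⁻¹) with hT
    obtain ⟨ρ, hρ1, hρ⟩ := exists_radius_le_add_of_frontier hWopen hφdiff hφbij hucont hbd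
      (half_pos hε) (T + ‖b‖)
    obtain ⟨r, hr, hr1⟩ := exists_between (max_lt hs.2 hρ1)
    have hsr : s < r := (le_max_left _ _).trans_lt hr
    have hr0 : 0 < r := hs.1.trans_lt hsr
    have hbound : ∀ z ∈ sphere (0 : ℂ) r,
        max (u (φ z) - K) 0 ≤ ε / 2 + (4 * D) • ‖h z‖ ^ 2 := by
      intro z hz
      rw [mem_sphere_zero_iff_norm] at hz
      have hz1 : z ∈ ball (0 : ℂ) 1 := by rwa [mem_ball_zero_iff, hz]
      refine max_le ?_ (by positivity)
      rw [smul_eq_mul]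
      by_cases hzT : ‖φ z‖ ≤ T + ‖b‖
      · have h1 := hρ z hz1 (by rw [hz]; exact (le_max_right _ _).trans_lt hr) hzT
        have h2 : 0 ≤ 4 * D * ‖h z‖ ^ 2 := by positivity
        linarith
      · have hTz : T ≤ ‖φ z - b‖ := by
          have := norm_sub_norm_le (φ z) b
          linarith
        have h1 := hgrowg z hz1 ((le_max_left _ _).trans hTz)
        have hB0 : 0 ≤ B := (norm_nonneg _).trans (hB z hz1)
        have h2 : (2 * B) ^ 2 ≤ ‖g z‖ ^ 2 := by
          rw [hgφ z hz1]
          calc (2 * B) ^ 2 = ((4 * B ^ 2) ^ p⁻¹) ^ p := by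
                rw [Real.rpow_inv_rpow (by positivity) hp.ne']
                ring
            _ ≤ _ := Real.rpow_le_rpow (by positivity) ((le_max_right _ _).trans hTz) hp.le
        have h3 : 2 * B ≤ ‖g z‖ := le_of_sq_le_sq h2 (norm_nonneg _)
        have h4 : ‖g z‖ ≤ 2 * ‖h z‖ := by
          have := norm_sub_norm_le (g z) (h z)
          have := hB z hz1
          linarith
        have h5 : ‖g z‖ ^ 2 ≤ 4 * ‖h z‖ ^ 2 := by
          calc ‖g z‖ ^ 2 ≤ (2 * ‖h z‖) ^ 2 := by gcongr
            _ = _ := by ring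
        have h6 := mul_le_mul_of_nonneg_left h5 hD0
        linarith
    have hhi : CircleIntegrable (fun z => (4 * D) • ‖h z‖ ^ 2) 0 r :=
      circleIntegrable_of_continuousOn_ball_s1 (by fun_prop) hr0.le hr1
    have hci : CircleIntegrable (fun _ : ℂ => ε / 2) 0 r :=
      continuousOn_const.circleIntegrable hr0.le
    have hsmall : 4 * D * Real.circleAverage (fun z => ‖h z‖ ^ 2) 0 r ≤ ε / 2 := by
      calc _ ≤ 4 * D * (ε / 2 / (4 * (D + 1))) := by gcongr; exact hh r ⟨hr0, hr1⟩
        _ ≤ 4 * (D + 1) * (ε / 2 / (4 * (D + 1))) := by gcongr; linarith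
        _ = ε / 2 := by field_simp
    calc Real.circleAverage ((fun z => max (u z - K) 0) ∘ φ) 0 s
        ≤ Real.circleAverage ((fun z => max (u z - K) 0) ∘ φ) 0 r := by
          refine circleAverage_comp_mono hφdiff hφbij.injOn ?_ ?_ hs.1 hsr hr1
          · rwa [hφbij.image_eq]
          · rw [hφbij.image_eq]
            exact fun c hc R hR hRW => husub.max_sub_le_circleAverage huW K hc hR hRW
      _ ≤ Real.circleAverage (fun z => ε / 2 + (4 * D) • ‖h z‖ ^ 2) 0 r := by
          refine Real.circleAverage_mono (circleIntegrable_of_continuousOn_ball_s1 hψ hr0.le hr1)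
            (hci.add hhi) fun z hz => ?_
          rw [abs_of_pos hr0] at hz
          exact hbound z hz
      _ = ε / 2 + 4 * D * Real.circleAverage (fun z => ‖h z‖ ^ 2) 0 r := by
          rw [Real.circleAverage_fun_add hci hhi, Real.circleAverage_const,
            Real.circleAverage_fun_smul, smul_eq_mul]
      _ ≤ ε := by linarith
  intro w hw
  obtain ⟨z, hz, rfl⟩ := hφbij.surjOn hw
  have hz1 : ‖z‖ < 1 := mem_ball_zero_iff.mp hz
  have h := eq_zero_of_circleAverage_nonpos (z := z)
    (hψ.mono fun y hy => by
      rw [mem_sphere_zero_iff_norm] at hy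
      rwa [mem_ball_zero_iff, hy])
    (fun _ _ => le_max_right _ _) (hmean ‖z‖ ⟨norm_nonneg z, hz1⟩)
  have h1 : u (φ z) - K ≤ 0 := (le_max_left _ _).trans h
  linarith
end

section
/- If φ : 𝔻 → ℂ is holomorphic and ‖φ‖_{H^p} < ∞ for some 0 < p < ∞, then the radial maximal function M_φ(θ) = sup_{0<r<1} |φ(r e^{iθ})| belongs to L^p([0, 2π]). -/
open Complex Metric Set Filter Topology MeasureTheory ENNReal

/-- Cauchy–Schwarz for the lower Lebesgue integral, in squared form. -/
theorem ENNReal.sq_lintegral_mul_le {α : Type*} [MeasurableSpace α] (μ : Measure α)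
    {f g : α → ℝ≥0∞} (hf : AEMeasurable f μ) (hg : AEMeasurable g μ) :
    (∫⁻ x, f x * g x ∂μ) ^ 2 ≤ (∫⁻ x, f x ^ 2 ∂μ) * ∫⁻ x, g x ^ 2 ∂μ := by
  have h := ENNReal.lintegral_mul_le_Lp_mul_Lq μ Real.HolderConjugate.two_two hf hg
  simp only [Pi.mul_apply, ENNReal.rpow_two] at h
  calc (∫⁻ x, f x * g x ∂μ) ^ 2
      ≤ ((∫⁻ x, f x ^ 2 ∂μ) ^ (1 / 2 : ℝ) * (∫⁻ x, g x ^ 2 ∂μ) ^ (1 / 2 : ℝ)) ^ 2 := by gcongr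
    _ = _ := by
      rw [mul_pow, ← ENNReal.rpow_two, ← ENNReal.rpow_two, ← ENNReal.rpow_mul,
        ← ENNReal.rpow_mul]
      norm_num

theorem ENNReal.le_of_sq_le_mul_self {a b : ℝ≥0∞} (ha : a ≠ ⊤) (h : a ^ 2 ≤ b * a) : a ≤ b := by
  rcases eq_or_ne a 0 with rfl | h0
  · simp
  · rw [sq] at h
    exact (ENNReal.mul_le_mul_iff_left h0 ha).1 h

/-- An `L²` bound for a positive kernel operator `T` by the `TT*` method: it suffices that the kernel
of `TT*` is dominated by a multiple of the kernel of `T + T*`. -/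
theorem lintegral_sq_kernel_le {α : Type*} [MeasurableSpace α] (μ : Measure α) [IsFiniteMeasure μ]
    {K : α → α → ℝ≥0∞} (hK : Measurable (Function.uncurry K)) {B C D : ℝ≥0∞} (hB : B ≠ ⊤)
    (hKB : ∀ x y, K x y ≤ B)
    (hKK : ∀ x y, ∫⁻ t, K x t * K y t ∂μ ≤ C * (K x y + K y x))
    {f : α → ℝ≥0∞} (hf : Measurable f) (hD : D ≠ ⊤) (hfD : ∀ x, f x ≤ D) :
    ∫⁻ x, (∫⁻ t, K x t * f t ∂μ) ^ 2 ∂μ ≤ (2 * C) ^ 2 * ∫⁻ t, f t ^ 2 ∂μ := by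
  set g : α → ℝ≥0∞ := fun x ↦ ∫⁻ t, K x t * f t ∂μ with hg
  set k : α → ℝ≥0∞ := fun t ↦ ∫⁻ x, K x t * g x ∂μ with hk
  have mK2 : Measurable fun q : α × α ↦ K q.1 q.2 := hK
  have mK2' : Measurable fun q : α × α ↦ K q.2 q.1 := hK.comp measurable_swap
  have mK1 (x : α) : Measurable (K x) := hK.comp measurable_prodMk_left
  have mK1' (t : α) : Measurable fun x ↦ K x t := hK.comp measurable_prodMk_right
  have mg : Measurable g := by
    exact Measurable.lintegral_prod_right' (f := fun q : α × α ↦ K q.1 q.2 * f q.2) (by fun_prop)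
  have mk : Measurable k := by
    exact Measurable.lintegral_prod_right' (f := fun q : α × α ↦ K q.2 q.1 * g q.2) (by fun_prop)
  have bound (u : α → ℝ≥0∞) (E : ℝ≥0∞) (hu : ∀ x, u x ≤ E) : ∫⁻ x, u x ∂μ ≤ E * μ univ :=
    (lintegral_mono hu).trans_eq (lintegral_const _)
  have fin : μ univ ≠ ⊤ := measure_ne_top μ univ
  have hgB : ∀ x, g x ≤ B * D * μ univ := fun x ↦
    bound _ _ fun t ↦ mul_le_mul' (hKB _ _) (hfD _)
  have hkB : ∀ x, k x ≤ B * (B * D * μ univ) * μ univ := fun x ↦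
    bound _ _ fun t ↦ mul_le_mul' (hKB _ _) (hgB _)
  have gfin : ∫⁻ x, g x ^ 2 ∂μ ≠ ⊤ :=
    ne_top_of_le_ne_top (by finiteness) (bound _ _ fun x ↦ pow_le_pow_left' (hgB x) 2)
  have kfin : ∫⁻ x, k x ^ 2 ∂μ ≠ ⊤ :=
    ne_top_of_le_ne_top (by finiteness) (bound _ _ fun x ↦ pow_le_pow_left' (hkB x) 2)
  have swap (u v : α → ℝ≥0∞) (mu : Measurable u) (mv : Measurable v) :
      ∫⁻ x, u x * ∫⁻ t, K x t * v t ∂μ ∂μ = ∫⁻ t, v t * ∫⁻ x, K x t * u x ∂μ ∂μ := by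
    calc ∫⁻ x, u x * ∫⁻ t, K x t * v t ∂μ ∂μ
        = ∫⁻ x, ∫⁻ t, u x * (K x t * v t) ∂μ ∂μ :=
          lintegral_congr fun x ↦ (lintegral_const_mul _ (by fun_prop)).symm
      _ = ∫⁻ t, ∫⁻ x, u x * (K x t * v t) ∂μ ∂μ :=
          lintegral_lintegral_swap (by unfold Function.uncurry; fun_prop)
      _ = _ := lintegral_congr fun t ↦ by
          rw [← lintegral_const_mul _ (by fun_prop)]
          exact lintegral_congr fun x ↦ by ring
  have h1 : ∫⁻ x, g x ^ 2 ∂μ = ∫⁻ t, f t * k t ∂μ := by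
    rw [← swap g f mg hf]
    exact lintegral_congr fun x ↦ sq _
  have h2 : ∫⁻ t, k t ^ 2 ∂μ ≤ 2 * C * ∫⁻ x, g x * k x ∂μ := by
    have e1 : ∫⁻ t, k t ^ 2 ∂μ = ∫⁻ x, g x * ∫⁻ t, K x t * k t ∂μ ∂μ := by
      rw [swap g k mg mk]
      exact lintegral_congr fun x ↦ sq _
    have e2 (x : α) : ∫⁻ t, K x t * k t ∂μ = ∫⁻ y, g y * ∫⁻ t, K x t * K y t ∂μ ∂μ := by
      calc ∫⁻ t, K x t * k t ∂μ = ∫⁻ y, g y * ∫⁻ t, K y t * K x t ∂μ ∂μ :=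
            (swap g (K x) mg (mK1 x)).symm
        _ = _ := lintegral_congr fun y ↦ by
            congr 1
            exact lintegral_congr fun t ↦ mul_comm _ _
    have e3 (x : α) : ∫⁻ t, K x t * k t ∂μ ≤ C * (k x + ∫⁻ y, K x y * g y ∂μ) := by
      rw [e2]
      calc ∫⁻ y, g y * ∫⁻ t, K x t * K y t ∂μ ∂μ
          ≤ ∫⁻ y, C * (K y x * g y + K x y * g y) ∂μ := by
            refine lintegral_mono fun y ↦ ?_
            calc _ ≤ g y * (C * (K x y + K y x)) := by gcongr; exact hKK x y
              _ = _ := by ring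
        _ = _ := by rw [lintegral_const_mul _ (by fun_prop), lintegral_add_left (by fun_prop)]
    have e4 : ∫⁻ x, g x * ∫⁻ y, K x y * g y ∂μ ∂μ = ∫⁻ x, g x * k x ∂μ := swap g g mg mg
    calc ∫⁻ t, k t ^ 2 ∂μ ≤ ∫⁻ x, C * (g x * k x + g x * ∫⁻ y, K x y * g y ∂μ) ∂μ := by
          rw [e1]
          refine lintegral_mono fun x ↦ ?_
          calc _ ≤ g x * (C * (k x + ∫⁻ y, K x y * g y ∂μ)) := by gcongr; exact e3 x
            _ = _ := by ring
      _ = 2 * C * ∫⁻ x, g x * k x ∂μ := by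
          have m : Measurable fun x ↦ ∫⁻ y, K x y * g y ∂μ :=
            Measurable.lintegral_prod_right' (f := fun q : α × α ↦ K q.1 q.2 * g q.2) (by fun_prop)
          rw [lintegral_const_mul _ (by fun_prop), lintegral_add_left (by fun_prop), e4]
          ring
  have h3 : ∫⁻ t, k t ^ 2 ∂μ ≤ (2 * C) ^ 2 * ∫⁻ x, g x ^ 2 ∂μ := by
    refine ENNReal.le_of_sq_le_mul_self kfin ?_
    calc (∫⁻ t, k t ^ 2 ∂μ) ^ 2 ≤ (2 * C * ∫⁻ x, g x * k x ∂μ) ^ 2 := by gcongr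
      _ = (2 * C) ^ 2 * (∫⁻ x, g x * k x ∂μ) ^ 2 := by ring
      _ ≤ (2 * C) ^ 2 * ((∫⁻ x, g x ^ 2 ∂μ) * ∫⁻ x, k x ^ 2 ∂μ) := by
          gcongr
          exact ENNReal.sq_lintegral_mul_le μ mg.aemeasurable mk.aemeasurable
      _ = _ := by ring
  refine ENNReal.le_of_sq_le_mul_self gfin ?_
  calc (∫⁻ x, g x ^ 2 ∂μ) ^ 2 = (∫⁻ t, f t * k t ∂μ) ^ 2 := by rw [h1]
    _ ≤ (∫⁻ t, f t ^ 2 ∂μ) * ∫⁻ t, k t ^ 2 ∂μ :=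
        ENNReal.sq_lintegral_mul_le μ hf.aemeasurable mk.aemeasurable
    _ ≤ (∫⁻ t, f t ^ 2 ∂μ) * ((2 * C) ^ 2 * ∫⁻ x, g x ^ 2 ∂μ) := by gcongr
    _ = _ := by ring

theorem norm_one_sub_conj_mul_of_norm_eq_one {w ζ : ℂ} (hζ : ‖ζ‖ = 1) :
    ‖1 - (starRingEnd ℂ) w * ζ‖ = ‖ζ - w‖ := by
  have h : 1 - (starRingEnd ℂ) w * ζ = (starRingEnd ℂ) (ζ - w) * ζ := by
    have : (starRingEnd ℂ) ζ * ζ = 1 := by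
      rw [← Complex.normSq_eq_conj_mul_self, Complex.normSq_eq_norm_sq, hζ]
      simp
    rw [map_sub, sub_mul, this]
  rw [h, norm_mul, hζ, mul_one, Complex.norm_conj]

theorem one_sub_conj_mul_ne_zero {w ζ : ℂ} (h : ‖w‖ * ‖ζ‖ < 1) :
    1 - (starRingEnd ℂ) w * ζ ≠ 0 := by
  intro h0
  have : ‖(starRingEnd ℂ) w * ζ‖ = 1 := by rw [← sub_eq_zero.1 h0]; simp
  rw [norm_mul, Complex.norm_conj] at this
  linarith

theorem norm_sub_le_norm_one_sub_conj_mul {w z : ℂ} (hw : ‖w‖ ≤ 1) (hz : ‖z‖ ≤ 1) :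
    ‖z - w‖ ≤ ‖1 - (starRingEnd ℂ) w * z‖ := by
  rw [← abs_norm, ← abs_norm (1 - _), ← sq_le_sq]
  have h1 : ‖w‖ ^ 2 ≤ 1 := by simpa using pow_le_pow_left₀ (norm_nonneg _) hw 2
  have h2 : ‖z‖ ^ 2 ≤ 1 := by simpa using pow_le_pow_left₀ (norm_nonneg _) hz 2
  simp only [← Complex.normSq_eq_norm_sq, Complex.normSq_apply, Complex.sub_re, Complex.sub_im,
    Complex.mul_re, Complex.mul_im, Complex.conj_re, Complex.conj_im, Complex.one_re,
    Complex.one_im] at *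
  nlinarith [mul_nonneg (sub_nonneg.2 h1) (sub_nonneg.2 h2)]

theorem continuousOn_poissonKernel {w : ℂ} (hw : ‖w‖ < 1) :
    ContinuousOn (poissonKernel 0 w) (sphere 0 1) := by
  unfold poissonKernel
  refine ContinuousOn.div (by fun_prop) (by fun_prop) fun ζ hζ ↦ ?_
  have : ζ - w ≠ 0 := by
    rintro h
    rw [sub_eq_zero.1 h, mem_sphere_zero_iff_norm] at hζ
    exact hw.ne hζ
  simpa using this

theorem circleAverage_poissonKernel_mul_poissonKernel {z w : ℂ} (hz : ‖z‖ < 1) (hw : ‖w‖ < 1) :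
    Real.circleAverage (fun ζ ↦ poissonKernel 0 z ζ * poissonKernel 0 w ζ) 0 1 =
      (1 - (‖z‖ * ‖w‖) ^ 2) / ‖1 - (starRingEnd ℂ) w * z‖ ^ 2 := by
  set F : ℂ → ℂ := fun ζ ↦ (1 + (starRingEnd ℂ) w * ζ) / (1 - (starRingEnd ℂ) w * ζ) with hF
  have reF (ζ : ℂ) : (F ζ).re =
      (1 - (‖ζ‖ * ‖w‖) ^ 2) / ‖1 - (starRingEnd ℂ) w * ζ‖ ^ 2 := by
    have := congrFun (poissonKernel_eq_re_herglotzRieszKernel (c := 0)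
      (w := (starRingEnd ℂ) w * ζ)) 1
    simp only [poissonKernel, herglotzRieszKernel, Function.comp, sub_zero, norm_one, norm_mul,
      Complex.norm_conj] at this
    rw [hF, ← this]
    ring
  have hd : DiffContOnCl ℂ F (ball 0 1) := by
    refine DifferentiableOn.diffContOnCl fun ζ hζ ↦ ?_
    rw [closure_ball _ one_ne_zero, mem_closedBall_zero_iff] at hζ
    have : 1 - (starRingEnd ℂ) w * ζ ≠ 0 :=
      one_sub_conj_mul_ne_zero (by nlinarith [norm_nonneg w, norm_nonneg ζ])
    have h : DifferentiableAt ℂ F ζ := by fun_prop (disch := assumption)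
    exact h.differentiableWithinAt
  have hp := hd.circleAverage_poissonKernel_smul (w := z) (by simpa using hz)
  have hint : CircleIntegrable (poissonKernel 0 z • F) 0 1 := by
    refine ContinuousOn.circleIntegrable zero_le_one ?_
    refine (continuousOn_poissonKernel hz).smul (hd.continuousOn.mono ?_)
    rw [closure_ball _ one_ne_zero]
    exact sphere_subset_closedBall
  have := Complex.reCLM.circleAverage_comp_comm hint
  rw [hp] at this
  rw [← reF, ← Complex.reCLM_apply, ← this]
  refine Real.circleAverage_congr_sphere fun ζ hζ ↦ ?_
  have h1 : ‖ζ‖ = 1 := by simpa using hζ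
  simp only [Function.comp, Pi.smul_apply', Complex.reCLM_apply, Complex.smul_re, smul_eq_mul, reF]
  rw [norm_one_sub_conj_mul_of_norm_eq_one h1]
  simp [poissonKernel, h1]

theorem one_sub_sq_div_norm_sq_le {r s : ℝ} (hr : 0 ≤ r) (hrs : r ≤ s) (hs : s < 1) {c : ℂ}
    (hc : ‖c‖ = 1) :
    (1 - (r * s) ^ 2) / ‖1 - (r * s : ℝ) * c‖ ^ 2 ≤ 8 * ((1 - r ^ 2) / ‖1 - r * c‖ ^ 2) := by
  have key (t : ℝ) (ht : 0 ≤ t) : 1 - t ≤ ‖1 - t * c‖ := by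
    have := norm_sub_norm_le (1 : ℂ) (t * c)
    simpa [hc, abs_of_nonneg ht] using this
  have h1 := key r hr
  have h2 := key (r * s) (mul_nonneg hr (hr.trans hrs))
  have h3 : ‖1 - r * c‖ ≤ ‖1 - (r * s : ℝ) * c‖ + r * (1 - s) := by
    have e : 1 - r * c = (1 - (r * s : ℝ) * c) - (r * (1 - s) : ℝ) * c := by push_cast; ring
    rw [e]
    refine (norm_sub_le _ _).trans_eq ?_
    rw [norm_mul, hc, Complex.norm_real, Real.norm_of_nonneg (by nlinarith), mul_one]
  have h4 : ‖1 - r * c‖ ≤ 2 * ‖1 - (r * s : ℝ) * c‖ := by nlinarith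
  have hpos : 0 < ‖1 - r * c‖ := by linarith
  rw [mul_div_assoc', div_le_div_iff₀ (by nlinarith [hpos]) (by positivity)]
  have h5 : ‖1 - r * c‖ ^ 2 ≤ 4 * ‖1 - (r * s : ℝ) * c‖ ^ 2 := by nlinarith
  have h6 : 1 - (r * s) ^ 2 ≤ 2 * (1 - r ^ 2) := by
    have h7 : (r * r) ^ 2 ≤ (r * s) ^ 2 := by gcongr
    nlinarith [sq_nonneg (1 - r ^ 2)]
  calc _ ≤ 2 * (1 - r ^ 2) * (4 * ‖1 - (r * s : ℝ) * c‖ ^ 2) := by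
        apply mul_le_mul h6 h5 (by positivity)
        nlinarith
    _ = _ := by ring

theorem circleAverage_poissonKernel_mul_poissonKernel_le {u v : ℂ} (hu : ‖u‖ = 1) (hv : ‖v‖ = 1)
    {r s : ℝ} (hr : 0 ≤ r) (hr1 : r < 1) (hs : 0 ≤ s) (hs1 : s < 1) :
    Real.circleAverage (fun ζ ↦ poissonKernel 0 (r * u) ζ * poissonKernel 0 (s * v) ζ) 0 1 ≤
      8 * (poissonKernel 0 (r * u) v + poissonKernel 0 (s * v) u) := by
  have nr : ‖r * u‖ = r := by simp [hu, abs_of_nonneg hr]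
  have ns : ‖s * v‖ = s := by simp [hv, abs_of_nonneg hs]
  rw [circleAverage_poissonKernel_mul_poissonKernel (by rwa [nr]) (by rwa [ns]), nr, ns]
  have pos1 : 0 ≤ poissonKernel 0 (r * u) v := by
    simp only [poissonKernel, sub_zero, hv, nr]
    exact div_nonneg (by nlinarith) (by positivity)
  have pos2 : 0 ≤ poissonKernel 0 (s * v) u := by
    simp only [poissonKernel, sub_zero, hu, ns]
    exact div_nonneg (by nlinarith) (by positivity)
  set c := (starRingEnd ℂ) v * u with hc
  have nc : ‖c‖ = 1 := by simp [hc, hu, hv]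
  have e : (starRingEnd ℂ) (s * v) * (r * u) = (r * s : ℝ) * c := by
    simp only [map_mul, Complex.conj_ofReal, hc]; push_cast; ring
  rw [e]
  rcases le_total r s with h | h
  · have := one_sub_sq_div_norm_sq_le hr h hs1 nc
    have e2 : poissonKernel 0 (r * u) v = (1 - r ^ 2) / ‖1 - r * c‖ ^ 2 := by
      simp only [poissonKernel, sub_zero, hv, nr]
      rw [← norm_one_sub_conj_mul_of_norm_eq_one hv, ← Complex.norm_conj]
      simp only [hc, map_sub, map_mul, map_one, Complex.conj_conj, Complex.conj_ofReal]
      ring_nf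
    rw [e2] at *
    linarith
  · have := one_sub_sq_div_norm_sq_le hs h hr1 nc
    have e2 : poissonKernel 0 (s * v) u = (1 - s ^ 2) / ‖1 - s * c‖ ^ 2 := by
      simp only [poissonKernel, sub_zero, hu, ns]
      rw [← norm_one_sub_conj_mul_of_norm_eq_one hu]
      simp only [hc, map_mul, Complex.conj_ofReal]
      ring_nf
    rw [e2] at *
    rw [mul_comm s r] at this
    linarith

theorem AnalyticOnNhd.exists_eqOn_prod_pow_mul {U : Set ℂ} (hU : IsPreconnected U)
    (hUc : IsCompact U) (hUp : Preperfect U) {f : ℂ → ℂ} (hf : AnalyticOnNhd ℂ f U)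
    {x : ℂ} (hx : x ∈ U) (hfx : f x ≠ 0) :
    ∃ (s : Finset ℂ) (n : ℂ → ℕ) (g : ℂ → ℂ), (s : Set ℂ) ⊆ U ∧ AnalyticOnNhd ℂ g U ∧
      (∀ z ∈ U, g z ≠ 0) ∧ EqOn f (fun z ↦ (∏ a ∈ s, (z - a) ^ n a) * g z) U := by
  have hm := hf.meromorphicOn
  have hord : ∀ u : U, meromorphicOrderAt f u ≠ ⊤ := by
    refine (hm.exists_meromorphicOrderAt_ne_top_iff_forall ⟨⟨x, hx⟩, hU⟩).1 ⟨⟨x, hx⟩, ?_⟩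
    rw [(hf x hx).meromorphicNFAt.meromorphicOrderAt_eq_zero_iff.2 hfx]
    simp
  have hfin := (MeromorphicOn.divisor f U).finiteSupport hUc
  obtain ⟨g, hg, hg0, hfg⟩ := hm.extract_zeros_poles hord hfin
  refine ⟨hfin.toFinset, fun a ↦ (MeromorphicOn.divisor f U a).toNat, g, ?_, hg,
    fun z hz ↦ hg0 ⟨z, hz⟩, ?_⟩
  · simpa using (MeromorphicOn.divisor f U).supportWithinDomain
  have hprod : (∏ᶠ u, (· - u) ^ MeromorphicOn.divisor f U u : ℂ → ℂ) =
      fun z ↦ ∏ a ∈ hfin.toFinset, (z - a) ^ (MeromorphicOn.divisor f U a).toNat := by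
    rw [finprod_eq_prod_of_mulSupport_subset (s := hfin.toFinset)]
    · ext z
      rw [Finset.prod_apply]
      refine Finset.prod_congr rfl fun a _ ↦ ?_
      have : 0 ≤ MeromorphicOn.divisor f U a := MeromorphicOn.AnalyticOnNhd.divisor_nonneg hf a
      simp only [Pi.pow_apply]
      conv_lhs => rw [← Int.toNat_of_nonneg this, zpow_natCast]
    · rw [Function.FactorizedRational.mulSupport]
      simp
  rw [hprod] at hfg
  have ha : AnalyticOnNhd ℂ
      (fun z ↦ (∏ a ∈ hfin.toFinset, (z - a) ^ (MeromorphicOn.divisor f U a).toNat) * g z) U :=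
    fun z hz ↦ (Finset.analyticAt_fun_prod _ fun a _ ↦ by fun_prop).mul (hg z hz)
  refine hf.eqOn_of_preconnected_of_frequently_eq ha hU hx ?_
  have := (hf x hx).meromorphicAt.eventuallyEq_nhdsNE_of_eventuallyEq_codiscreteWithin
    (ha x hx).meromorphicAt hx (hUp x hx) hfg
  exact this.frequently

/-- Dividing out the zeros in the open disk by Blaschke factors: `f` is
dominated on the closed disk by a function without zeros in the open disk and with the same modulus
on the circle. -/
theorem AnalyticOnNhd.exists_norm_le_ne_zero {f : ℂ → ℂ}
    (hf : AnalyticOnNhd ℂ f (closedBall 0 1)) {x : ℂ} (hx : x ∈ closedBall (0 : ℂ) 1)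
    (hfx : f x ≠ 0) :
    ∃ G : ℂ → ℂ, AnalyticOnNhd ℂ G (closedBall 0 1) ∧ (∀ z ∈ ball (0 : ℂ) 1, G z ≠ 0) ∧
      (∀ z ∈ closedBall (0 : ℂ) 1, ‖f z‖ ≤ ‖G z‖) ∧ ∀ z ∈ sphere (0 : ℂ) 1, ‖G z‖ = ‖f z‖ := by
  have hp : Preperfect (closedBall (0 : ℂ) 1) := by
    rw [← closure_ball _ one_ne_zero]
    exact (isOpen_ball.preperfect).perfect_closure.acc
  obtain ⟨s, n, g, hs, hg, hg0, hfg⟩ := hf.exists_eqOn_prod_pow_mul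
    (convex_closedBall 0 1).isPreconnected (isCompact_closedBall 0 1) hp hx hfx
  have hs1 : ∀ a ∈ s, ‖a‖ ≤ 1 := fun a ha ↦ by simpa using hs ha
  refine ⟨fun z ↦ (∏ a ∈ s, (1 - (starRingEnd ℂ) a * z) ^ n a) * g z, fun z hz ↦
    (Finset.analyticAt_fun_prod _ fun a _ ↦ by fun_prop).mul (hg z hz), fun z hz ↦ ?_,
    fun z hz ↦ ?_, fun z hz ↦ ?_⟩
  · refine mul_ne_zero (Finset.prod_ne_zero_iff.2 fun a ha ↦ pow_ne_zero _ ?_)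
      (hg0 z (ball_subset_closedBall hz))
    rw [mem_ball_zero_iff] at hz
    exact one_sub_conj_mul_ne_zero (by nlinarith [hs1 a ha, norm_nonneg a, norm_nonneg z])
  · rw [hfg hz]
    simp only [norm_mul, norm_prod, norm_pow]
    gcongr with a ha
    exact norm_sub_le_norm_one_sub_conj_mul (hs1 a ha) (by simpa using hz)
  · rw [hfg (sphere_subset_closedBall hz)]
    simp only [norm_mul, norm_prod, norm_pow]
    congr 1
    refine Finset.prod_congr rfl fun a _ ↦ ?_
    rw [norm_one_sub_conj_mul_of_norm_eq_one (by simpa using hz)]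

theorem DifferentiableOn.exists_norm_eq_rpow {G : ℂ → ℂ} {c : ℂ} {r : ℝ}
    (hG : DifferentiableOn ℂ G (ball c r)) (hG0 : ∀ z ∈ ball c r, G z ≠ 0) (q : ℝ) :
    ∃ h : ℂ → ℂ, DifferentiableOn ℂ h (ball c r) ∧ ∀ z ∈ ball c r, ‖h z‖ = ‖G z‖ ^ q := by
  obtain ⟨L, hL⟩ := DifferentiableOn.isExactOn_ball
    ((hG.deriv isOpen_ball).div hG hG0)
  have hGd : ∀ z ∈ ball c r, HasDerivAt G (_root_.deriv G z) z := fun z hz ↦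
    (hG.differentiableAt (isOpen_ball.mem_nhds hz)).hasDerivAt
  have hd : ∀ z ∈ ball c r, HasDerivAt (fun z ↦ G z * cexp (-L z)) 0 z := fun z hz ↦ by
    have := (hGd z hz).mul (hL z hz).neg.cexp
    convert! this using 1
    simp only [Pi.div_apply]
    field_simp [hG0 z hz]
    ring
  have hconst : ∃ k : ℂ, ∀ z ∈ ball c r, G z * cexp (-L z) = k :=
    isOpen_ball.exists_is_const_of_deriv_eq_zero (convex_ball c r).isPreconnected
      (fun z hz ↦ (hd z hz).differentiableAt.differentiableWithinAt) fun z hz ↦ (hd z hz).deriv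
  obtain ⟨k, hk⟩ := hconst
  refine ⟨fun z ↦ (‖k‖ ^ q : ℝ) * cexp (q * L z), fun z hz ↦ ?_, fun z hz ↦ ?_⟩
  · exact ((((hL z hz).const_mul (q : ℂ)).cexp).const_mul
      _).differentiableAt.differentiableWithinAt
  · have : G z = k * cexp (L z) := by
      rw [← hk z hz, mul_assoc, ← Complex.exp_add]
      simp
    rw [this, norm_mul, norm_mul, Real.mul_rpow (norm_nonneg _) (norm_nonneg _),
      Complex.norm_exp, Complex.norm_exp, ← Real.exp_mul, Complex.norm_real,
      Real.norm_of_nonneg (by positivity), Complex.re_ofReal_mul, mul_comm q]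

theorem poissonKernel_zero_nonneg {w ζ : ℂ} (h : ‖w‖ ≤ ‖ζ‖) : 0 ≤ poissonKernel 0 w ζ := by
  simp only [poissonKernel, sub_zero]
  exact div_nonneg (sub_nonneg.2 (by gcongr)) (by positivity)

theorem poissonKernel_zero_le {w ζ : ℂ} {R : ℝ} (hw : ‖w‖ ≤ R) (hR : R < 1) (hζ : ‖ζ‖ = 1) :
    poissonKernel 0 w ζ ≤ ((1 - R) ^ 2)⁻¹ := by
  simp only [poissonKernel, sub_zero, hζ]
  have h1 : 1 - R ≤ ‖ζ - w‖ := by linarith [norm_sub_norm_le ζ w]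
  have h2 : (1 - R) ^ 2 ≤ ‖ζ - w‖ ^ 2 := pow_le_pow_left₀ (by linarith) h1 2
  have h3 : 0 < (1 - R) ^ 2 := pow_pos (by linarith) 2
  rw [← one_div]
  exact div_le_div₀ zero_le_one (by nlinarith [norm_nonneg w]) h3 h2

theorem circleAverage_zero_one_eq_integral {E : Type*} [NormedAddCommGroup E] [NormedSpace ℝ E]
    (F : ℂ → E) : Real.circleAverage F 0 1 =
      ∫ t in Ioc 0 (2 * Real.pi), (2 * Real.pi)⁻¹ • F (cexp (t * I)) := by
  rw [Real.circleAverage_def, intervalIntegral.integral_of_le Real.two_pi_pos.le, integral_smul]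
  simp [circleMap]

theorem lintegral_ofReal_eq_circleAverage {F : ℂ → ℝ} (hF : ContinuousOn F (sphere 0 1))
    (h0 : ∀ ζ ∈ sphere 0 1, 0 ≤ F ζ) :
    ∫⁻ t in Ioc 0 (2 * Real.pi), ENNReal.ofReal ((2 * Real.pi)⁻¹ * F (cexp (t * I))) =
      ENNReal.ofReal (Real.circleAverage F 0 1) := by
  have hmem (t : ℝ) : cexp (t * I) ∈ sphere (0 : ℂ) 1 := by simp
  have hc : Continuous fun t : ℝ ↦ F (cexp (t * I)) :=
    hF.comp_continuous (by fun_prop) hmem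
  rw [circleAverage_zero_one_eq_integral, ofReal_integral_eq_lintegral_ofReal]
  · rfl
  · exact (hc.const_smul (2 * Real.pi)⁻¹).integrableOn_Ioc
  · exact ae_of_all _ fun t ↦ smul_nonneg (by positivity) (h0 _ (hmem t))

/-- The `L²` radial maximal inequality, linearized by a measurable choice `ρ` of radii. -/
theorem lintegral_sq_enorm_radial_le {h : ℂ → ℂ} (hd : DiffContOnCl ℂ h (ball 0 1)) {ρ : ℝ → ℝ}
    (mρ : Measurable ρ) {R : ℝ} (hR : R < 1) (h0 : ∀ x, 0 ≤ ρ x) (hρ : ∀ x, ρ x ≤ R) :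
    ∫⁻ x in Ioc 0 (2 * Real.pi), ‖h (ρ x * cexp (x * I))‖ₑ ^ 2 ≤
      256 * ∫⁻ x in Ioc 0 (2 * Real.pi), ‖h (cexp (x * I))‖ₑ ^ 2 := by
  set K : ℝ → ℝ → ℝ≥0∞ := fun x t ↦
    ENNReal.ofReal ((2 * Real.pi)⁻¹ * poissonKernel 0 (ρ x * cexp (x * I)) (cexp (t * I))) with hK
  have hn (t : ℝ) : ‖cexp (t * I)‖ = 1 := Complex.norm_exp_ofReal_mul_I t
  have hz (x : ℝ) : ‖ρ x * cexp (x * I)‖ ≤ R := by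
    simpa [hn, abs_of_nonneg (h0 x)] using hρ x
  have hz1 (x : ℝ) : ‖ρ x * cexp (x * I)‖ < 1 := (hz x).trans_lt hR
  have hpos (x : ℝ) (ζ : ℂ) (hζ : ‖ζ‖ = 1) : 0 ≤ poissonKernel 0 (ρ x * cexp (x * I)) ζ :=
    poissonKernel_zero_nonneg (hζ ▸ (hz1 x).le)
  have hcs : ContinuousOn h (sphere 0 1) := hd.continuousOn.mono <| by
    rw [closure_ball _ one_ne_zero]
    exact sphere_subset_closedBall
  have hc : Continuous fun t : ℝ ↦ h (cexp (t * I)) :=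
    hcs.comp_continuous (by fun_prop) fun t ↦ by simp
  obtain ⟨D, hD⟩ := (isCompact_sphere (0 : ℂ) 1).exists_bound_of_continuousOn hcs
  have mK : Measurable (Function.uncurry K) := by
    simp only [hK, poissonKernel]
    unfold Function.uncurry
    fun_prop
  have bK (x y : ℝ) : K x y ≤ ENNReal.ofReal ((2 * Real.pi)⁻¹ * ((1 - R) ^ 2)⁻¹) := by
    refine ENNReal.ofReal_le_ofReal ?_
    gcongr
    exact poissonKernel_zero_le (hz x) hR (hn y)
  have kK (x y : ℝ) :
      ∫⁻ t in Ioc 0 (2 * Real.pi), K x t * K y t ≤ 8 * (K x y + K y x) := by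
    set P : ℂ → ℝ := fun ζ ↦
      poissonKernel 0 (ρ x * cexp (x * I)) ζ * poissonKernel 0 (ρ y * cexp (y * I)) ζ with hP
    have e (t : ℝ) : K x t * K y t = ENNReal.ofReal (2 * Real.pi)⁻¹ *
        ENNReal.ofReal ((2 * Real.pi)⁻¹ * P (cexp (t * I))) := by
      simp only [hK, hP]
      rw [← ENNReal.ofReal_mul (mul_nonneg (by positivity) (hpos x _ (hn t))),
        ← ENNReal.ofReal_mul (p := (2 * Real.pi)⁻¹) (by positivity)]
      congr 1
      ring
    have hPc : ContinuousOn P (sphere 0 1) :=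
      (continuousOn_poissonKernel (hz1 x)).mul (continuousOn_poissonKernel (hz1 y))
    have hP0 : ∀ ζ ∈ sphere (0 : ℂ) 1, 0 ≤ P ζ := fun ζ hζ ↦ by
      rw [mem_sphere_zero_iff_norm] at hζ
      exact mul_nonneg (hpos x ζ hζ) (hpos y ζ hζ)
    simp only [e]
    rw [lintegral_const_mul' _ _ ENNReal.ofReal_ne_top, lintegral_ofReal_eq_circleAverage hPc hP0,
      hK, ← ENNReal.ofReal_add (mul_nonneg (by positivity) (hpos _ _ (hn y)))
        (mul_nonneg (by positivity) (hpos _ _ (hn x))), ← ENNReal.ofReal_mul (by positivity),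
      show (8 : ℝ≥0∞) = ENNReal.ofReal 8 by simp, ← ENNReal.ofReal_mul (by positivity)]
    refine ENNReal.ofReal_le_ofReal ?_
    have := circleAverage_poissonKernel_mul_poissonKernel_le (hn x) (hn y) (h0 x)
      ((hρ x).trans_lt hR) (h0 y) ((hρ y).trans_lt hR)
    calc _ ≤ (2 * Real.pi)⁻¹ * (8 * (poissonKernel 0 (ρ x * cexp (x * I)) (cexp (y * I)) +
          poissonKernel 0 (ρ y * cexp (y * I)) (cexp (x * I)))) := by gcongr
      _ = _ := by ring
  have hrep (x : ℝ) : ‖h (ρ x * cexp (x * I))‖ₑ ≤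
      ∫⁻ t in Ioc 0 (2 * Real.pi), K x t * ‖h (cexp (t * I))‖ₑ := by
    rw [← hd.circleAverage_poissonKernel_smul (w := ρ x * cexp (x * I)) (by simpa using hz1 x),
      circleAverage_zero_one_eq_integral]
    refine (enorm_integral_le_lintegral_enorm _).trans_eq (lintegral_congr fun t ↦ ?_)
    rw [Pi.smul_apply', smul_smul, enorm_smul,
      Real.enorm_of_nonneg (mul_nonneg (by positivity) (hpos _ _ (hn t)))]
  calc _ ≤ ∫⁻ x in Ioc 0 (2 * Real.pi),
        (∫⁻ t in Ioc 0 (2 * Real.pi), K x t * ‖h (cexp (t * I))‖ₑ) ^ 2 := by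
        gcongr with x
        exact hrep x
    _ ≤ (2 * 8) ^ 2 * ∫⁻ x in Ioc 0 (2 * Real.pi), ‖h (cexp (x * I))‖ₑ ^ 2 :=
        lintegral_sq_kernel_le _ mK ENNReal.ofReal_ne_top bK kK hc.enorm.measurable
          (D := ENNReal.ofReal D) ENNReal.ofReal_ne_top fun t ↦ by
            rw [← ofReal_norm]
            exact ENNReal.ofReal_le_ofReal (hD _ (by simp))
    _ = _ := by norm_num

/-- The `L^p` radial maximal inequality, linearized by a measurable choice `ρ` of radii. -/
theorem lintegral_rpow_enorm_radial_le {f : ℂ → ℂ} (hf : AnalyticOnNhd ℂ f (closedBall 0 1))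
    {p : ℝ} (hp : 0 < p) {ρ : ℝ → ℝ} (mρ : Measurable ρ) {R : ℝ} (hR : R < 1)
    (h0 : ∀ x, 0 ≤ ρ x) (hρ : ∀ x, ρ x ≤ R) :
    ∫⁻ x in Ioc 0 (2 * Real.pi), ‖f (ρ x * cexp (x * I))‖ₑ ^ p ≤
      256 * ∫⁻ x in Ioc 0 (2 * Real.pi), ‖f (cexp (x * I))‖ₑ ^ p := by
  have hn (t : ℝ) : ‖cexp (t * I)‖ = 1 := Complex.norm_exp_ofReal_mul_I t
  have hz (x : ℝ) : ‖ρ x * cexp (x * I)‖ ≤ R := by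
    simpa [hn, abs_of_nonneg (h0 x)] using hρ x
  by_cases hzero : ∀ z ∈ closedBall (0 : ℂ) 1, f z = 0
  · have : ∀ x : ℝ, f (ρ x * cexp (x * I)) = 0 := fun x ↦
      hzero _ (by simpa only [mem_closedBall_zero_iff] using (hz x).trans hR.le)
    simp [this, hp]
  push Not at hzero
  obtain ⟨w, hw, hfw⟩ := hzero
  obtain ⟨G, hG, hG0, hfG, hGf⟩ := hf.exists_norm_le_ne_zero hw hfw
  obtain ⟨h, hh, hhG⟩ := DifferentiableOn.exists_norm_eq_rpow
    (hG.differentiableOn.mono ball_subset_closedBall) hG0 (p / 2)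
  have ehG : ∀ z ∈ ball (0 : ℂ) 1, ‖h z‖ₑ ^ 2 = ‖G z‖ₑ ^ p := fun z hz ↦ by
    rw [← ofReal_norm, hhG z hz, ← ENNReal.ofReal_rpow_of_nonneg (norm_nonneg _) (by positivity),
      ofReal_norm, ← ENNReal.rpow_two, ← ENNReal.rpow_mul]
    congr 1
    ring
  have key : ∀ s ∈ Ioo (max R 0) 1,
      ∫⁻ x in Ioc 0 (2 * Real.pi), ‖f (ρ x * cexp (x * I))‖ₑ ^ p ≤
        256 * ∫⁻ x in Ioc 0 (2 * Real.pi), ‖G (s * cexp (x * I))‖ₑ ^ p := by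
    rintro s ⟨hs, hs1⟩
    obtain ⟨hRs, hs0⟩ := max_lt_iff.1 hs
    have hmaps : ∀ z ∈ closedBall (0 : ℂ) 1, (s : ℂ) * z ∈ ball (0 : ℂ) 1 := fun z hz ↦ by
      rw [mem_closedBall_zero_iff] at hz
      rw [mem_ball_zero_iff, norm_mul, Complex.norm_real, Real.norm_of_nonneg hs0.le]
      nlinarith
    have hd : DiffContOnCl ℂ (fun z ↦ h (s * z)) (ball 0 1) := by
      refine DifferentiableOn.diffContOnCl ?_
      rw [closure_ball _ one_ne_zero]
      exact hh.comp (by fun_prop) hmaps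
    have := lintegral_sq_enorm_radial_le hd (ρ := fun x ↦ ρ x / s) (mρ.div_const s) (R := R / s)
      ((div_lt_one hs0).2 hRs) (fun x ↦ div_nonneg (h0 x) hs0.le)
      fun x ↦ by gcongr; exact hρ x
    refine le_trans ?_ (this.trans_eq ?_)
    · refine lintegral_mono fun x ↦ ?_
      have e : (s : ℂ) * ((ρ x / s : ℝ) * cexp (x * I)) = ρ x * cexp (x * I) := by
        have : (s : ℂ) ≠ 0 := by exact_mod_cast hs0.ne'
        push_cast
        field_simp
      have hb : ρ x * cexp (x * I) ∈ ball (0 : ℂ) 1 := by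
        simpa only [mem_ball_zero_iff] using (hz x).trans_lt hR
      simp only [e, ehG _ hb]
      gcongr
      exact enorm_le_iff_norm_le.2 (hfG _ (ball_subset_closedBall hb))
    · congr 1
      exact lintegral_congr fun x ↦ ehG _ (hmaps _ (by simp))
  obtain ⟨D, hD⟩ := (isCompact_closedBall (0 : ℂ) 1).exists_bound_of_continuousOn hG.continuousOn
  have hlim : Tendsto (fun s : ℝ ↦ ∫⁻ x in Ioc 0 (2 * Real.pi), ‖G (s * cexp (x * I))‖ₑ ^ p)
      (𝓝[<] 1) (𝓝 (∫⁻ x in Ioc 0 (2 * Real.pi), ‖G (cexp (x * I))‖ₑ ^ p)) := by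
    have hev : ∀ᶠ s : ℝ in 𝓝[<] 1, s ∈ Ioo (0 : ℝ) 1 := Ioo_mem_nhdsLT zero_lt_one
    have hmem (s : ℝ) (hs : s ∈ Ioo (0 : ℝ) 1) (x : ℝ) :
        (s : ℂ) * cexp (x * I) ∈ closedBall (0 : ℂ) 1 := by
      simp [hn, abs_of_pos hs.1, hs.2.le]
    refine tendsto_lintegral_filter_of_dominated_convergence
      (fun _ ↦ ENNReal.ofReal D ^ p) ?_ ?_ ?_ ?_
    · filter_upwards [hev] with s hs
      have : Continuous fun x : ℝ ↦ G (s * cexp (x * I)) :=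
        hG.continuousOn.comp_continuous (by fun_prop) (hmem s hs)
      exact this.enorm.measurable.pow_const p
    · filter_upwards [hev] with s hs
      refine ae_of_all _ fun x ↦ ?_
      rw [← ofReal_norm]
      gcongr
      exact hD _ (hmem s hs x)
    · rw [lintegral_const]
      finiteness
    · refine ae_of_all _ fun x ↦ ?_
      have hGx : ContinuousAt G (cexp (x * I)) := (hG _ (by simp)).continuousAt
      have ht : Tendsto (fun s : ℝ ↦ (s : ℂ) * cexp (x * I)) (𝓝[<] 1) (𝓝 (cexp (x * I))) := by
        have : Continuous fun s : ℝ ↦ (s : ℂ) * cexp (x * I) := by fun_prop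
        simpa using (this.tendsto 1).mono_left nhdsWithin_le_nhds
      exact (hGx.tendsto.comp ht).enorm.ennrpow_const p
  have hsphere : ∫⁻ x in Ioc 0 (2 * Real.pi), ‖G (cexp (x * I))‖ₑ ^ p =
      ∫⁻ x in Ioc 0 (2 * Real.pi), ‖f (cexp (x * I))‖ₑ ^ p :=
    lintegral_congr fun x ↦ by
      rw [← ofReal_norm, hGf _ (by simp), ofReal_norm]
  rw [← hsphere]
  refine ge_of_tendsto (ENNReal.Tendsto.const_mul hlim (.inr (by simp))) ?_
  filter_upwards [Ioo_mem_nhdsLT (max_lt hR zero_lt_one)] with s hs using key s hs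

/-- The maximum of finitely many measurable functions is attained at a measurable choice of index. -/
theorem exists_measurable_partialSups_eq {α β : Type*} [MeasurableSpace α] [LinearOrder β]
    [TopologicalSpace β] [OrderClosedTopology β] [SecondCountableTopology β] [MeasurableSpace β]
    [OpensMeasurableSpace β] {F : ℕ → α → β} (hF : ∀ n, Measurable (F n)) (n : ℕ) :
    ∃ i : α → ℕ, Measurable i ∧ ∀ x, i x ≤ n ∧ partialSups (fun k ↦ F k x) n = F (i x) x := by
  classical
  induction n with
  | zero => exact ⟨fun _ ↦ 0, measurable_const, fun x ↦ by simp⟩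
  | succ n ih =>
    obtain ⟨i, mi, hi⟩ := ih
    have mFi : Measurable fun x ↦ F (i x) x :=
      (measurable_from_prod_countable_right (f := fun q : ℕ × α ↦ F q.1 q.2) hF).comp
        (mi.prodMk measurable_id)
    refine ⟨fun x ↦ if F (n + 1) x ≤ F (i x) x then i x else n + 1,
      mi.ite (measurableSet_le (hF _) mFi) measurable_const, fun x ↦ ?_⟩
    obtain ⟨h1, h2⟩ := hi x
    rw [partialSups_add_one, h2]
    beta_reduce
    split_ifs with h
    · exact ⟨by lia, sup_eq_left.2 h⟩
    · exact ⟨le_rfl, sup_eq_right.2 (not_le.1 h).le⟩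

/-- Hardy–Littlewood: if `φ` is holomorphic on the unit disk with
finite `H^p` Hardy norm, then the radial maximal function
`M_φ(θ) = sup_{0<r<1} |φ(re^{iθ})|` belongs to `L^p([0,2π])`. -/
theorem radial_maximal_memLp
    (φ : ℂ → ℂ) (hφ : DifferentiableOn ℂ φ (ball (0:ℂ) 1))
    (p : ℝ) (hp : 0 < p)
    (hHardy : ∃ M : ℝ, ∀ r ∈ Ioo (0:ℝ) 1,
      (1/(2*Real.pi)) * ∫ θ in (0:ℝ)..(2*Real.pi),
        ‖φ ((r:ℂ) * Complex.exp (θ * Complex.I))‖ ^ p ≤ M) :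
    (∫⁻ θ in Icc (0:ℝ) (2*Real.pi),
      (⨆ r ∈ Ioo (0:ℝ) 1,
        (‖φ ((r:ℂ) * Complex.exp (θ * Complex.I))‖₊ : ℝ≥0∞)) ^ p) < ⊤ := by
  obtain ⟨M, hM⟩ := hHardy
  have : Nonempty (Ioo (0 : ℝ) 1) := ⟨⟨1 / 2, by norm_num⟩⟩
  set q : ℕ → Ioo (0 : ℝ) 1 := TopologicalSpace.denseSeq _ with hq
  have hn (t : ℝ) : ‖cexp (t * I)‖ = 1 := Complex.norm_exp_ofReal_mul_I t
  have hmem (r : ℝ) (hr : r ∈ Ioo (0 : ℝ) 1) (x : ℝ) :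
      (r : ℂ) * cexp (x * I) ∈ ball (0 : ℂ) 1 := by
    simp [hn, abs_of_pos hr.1, hr.2]
  set F : ℕ → ℝ → ℝ≥0∞ := fun n x ↦ ‖φ ((q n : ℝ) * cexp (x * I))‖ₑ with hF
  have mF (n : ℕ) : Measurable (F n) := by
    have : Continuous fun x : ℝ ↦ φ ((q n : ℝ) * cexp (x * I)) :=
      hφ.continuousOn.comp_continuous (by fun_prop) (hmem _ (q n).2)
    exact this.enorm.measurable
  have hsup (x : ℝ) : (⨆ r ∈ Ioo (0:ℝ) 1, (‖φ ((r:ℂ) * cexp (x * I))‖₊ : ℝ≥0∞)) ≤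
      ⨆ n, partialSups (fun k ↦ F k x) n := by
    rw [iSup_partialSups_eq]
    have hc : Continuous fun r : Ioo (0 : ℝ) 1 ↦ ‖φ ((r : ℝ) * cexp (x * I))‖ₑ :=
      (hφ.continuousOn.comp_continuous (by fun_prop) fun r ↦ hmem _ r.2 x).enorm
    have hcl : IsClosed {r : Ioo (0 : ℝ) 1 | ‖φ ((r : ℝ) * cexp (x * I))‖ₑ ≤ ⨆ n, F n x} :=
      isClosed_le hc continuous_const
    refine iSup₂_le fun r hr ↦ ?_
    have hsub : range q ⊆ {r : Ioo (0 : ℝ) 1 | ‖φ ((r : ℝ) * cexp (x * I))‖ₑ ≤ ⨆ n, F n x} := by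
      rintro _ ⟨n, rfl⟩
      exact le_iSup (fun n ↦ F n x) n
    exact hcl.closure_subset_iff.2 hsub (TopologicalSpace.denseRange_denseSeq _ ⟨r, hr⟩)
  have hfin (n : ℕ) : ∫⁻ x in Ioc 0 (2 * Real.pi), (partialSups (fun k ↦ F k x) n) ^ p ≤
      256 * ENNReal.ofReal (2 * Real.pi * M) := by
    obtain ⟨i, mi, hi⟩ := exists_measurable_partialSups_eq mF n
    set R₀ := partialSups (fun k ↦ (q k : ℝ)) n with hR₀
    have hle (k : ℕ) (hk : k ≤ n) : (q k : ℝ) ≤ R₀ := le_partialSups_of_le (fun k ↦ (q k : ℝ)) hk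
    have hR₀1 : R₀ < 1 := by
      obtain ⟨k, -, hk⟩ := exists_partialSups_eq (fun k ↦ (q k : ℝ)) n
      exact hk.trans_lt (q k).2.2
    obtain ⟨R, hR₀R, hR1⟩ := exists_between hR₀1
    have hR0 : 0 < R := ((q 0).2.1.trans_le (hle 0 n.zero_le)).trans hR₀R
    have hRC : (R : ℂ) ≠ 0 := by exact_mod_cast hR0.ne'
    have hf : AnalyticOnNhd ℂ (fun z ↦ φ (R * z)) (closedBall 0 1) := fun z hz ↦ by
      have hb : (R : ℂ) * z ∈ ball (0 : ℂ) 1 := by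
        rw [mem_closedBall_zero_iff] at hz
        rw [mem_ball_zero_iff, norm_mul, Complex.norm_real, Real.norm_of_nonneg hR0.le]
        nlinarith
      exact (hφ.analyticAt (isOpen_ball.mem_nhds hb)).fun_comp (by fun_prop)
    have mq : Measurable fun x ↦ (q (i x) : ℝ) / R :=
      (measurable_from_nat (f := fun n ↦ (q n : ℝ) / R)).comp mi
    have hmain := lintegral_rpow_enorm_radial_le hf hp mq ((div_lt_one hR0).2 hR₀R)
      (fun x ↦ div_nonneg (q _).2.1.le hR0.le) fun x ↦ by gcongr; exact hle _ (hi x).1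
    have hcont : Continuous fun x : ℝ ↦ ‖φ (R * cexp (x * I))‖ ^ p :=
      (hφ.continuousOn.comp_continuous (by fun_prop) (hmem R ⟨hR0, hR1⟩)).norm.rpow_const
        fun _ ↦ .inr hp.le
    calc _ = ∫⁻ x in Ioc 0 (2 * Real.pi),
          ‖φ (R * (((q (i x) : ℝ) / R : ℝ) * cexp (x * I)))‖ₑ ^ p := by
          refine lintegral_congr fun x ↦ ?_
          rw [(hi x).2, hF]
          congr 4
          push_cast
          field_simp
      _ ≤ 256 * ∫⁻ x in Ioc 0 (2 * Real.pi), ‖φ (R * cexp (x * I))‖ₑ ^ p := hmain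
      _ ≤ _ := by
          gcongr
          calc _ = ∫⁻ x in Ioc 0 (2 * Real.pi), ENNReal.ofReal (‖φ (R * cexp (x * I))‖ ^ p) := by
                refine lintegral_congr fun x ↦ ?_
                rw [← ofReal_norm, ENNReal.ofReal_rpow_of_nonneg (norm_nonneg _) hp.le]
            _ = ENNReal.ofReal (∫ x in (0 : ℝ)..2 * Real.pi, ‖φ (R * cexp (x * I))‖ ^ p) := by
                rw [intervalIntegral.integral_of_le Real.two_pi_pos.le,
                  ofReal_integral_eq_lintegral_ofReal hcont.integrableOn_Ioc
                    (ae_of_all _ fun x ↦ by positivity)]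
            _ ≤ _ := by
                refine ENNReal.ofReal_le_ofReal ?_
                have := hM R ⟨hR0, hR1⟩
                rwa [one_div_mul_eq_div, div_le_iff₀' Real.two_pi_pos] at this
  rw [← Measure.restrict_congr_set Ioc_ae_eq_Icc]
  have hmono (x : ℝ) : Monotone fun n ↦ partialSups (fun k ↦ F k x) n :=
    (partialSups fun k ↦ F k x).monotone
  have mps (n : ℕ) : Measurable fun x ↦ partialSups (fun k ↦ F k x) n := by
    simp only [partialSups_eq_sup'_range]
    fun_prop
  calc _ ≤ ∫⁻ x in Ioc 0 (2 * Real.pi), (⨆ n, partialSups (fun k ↦ F k x) n) ^ p := by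
        gcongr with x
        exact hsup x
    _ = ∫⁻ x in Ioc 0 (2 * Real.pi), ⨆ n, (partialSups (fun k ↦ F k x) n) ^ p :=
        lintegral_congr fun x ↦ (ENNReal.orderIsoRpow p hp).map_iSup _
    _ = ⨆ n, ∫⁻ x in Ioc 0 (2 * Real.pi), (partialSups (fun k ↦ F k x) n) ^ p :=
        lintegral_iSup (fun n ↦ (mps n).pow_const p) fun m n hmn x ↦
          ENNReal.rpow_le_rpow (hmono x hmn) hp.le
    _ ≤ 256 * ENNReal.ofReal (2 * Real.pi * M) := iSup_le hfin
    _ < ⊤ := by finiteness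
end
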